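/- arXiv:math/0612794 — 6 statements merged into one kernel-verified Lean document; each statement's English description precedes it below -/
import Mathlib

section
/- Let D be a compact topological space and let L : D × ℝ^l → HM_n be continuous and such that for each fixed p ∈ D the map h ↦ L(p, h) is affine. If for every p ∈ D there exists h ∈ ℝ^l with L(p, h) ≻ 0, then there exists a continuous function h : D → ℝ^l such that L(p, h(p)) ≻ 0 for all p ∈ D. -/
open Matrix ComplexOrder

/-- Positive definiteness is detected on the unit sphere of the sup norm. -/
theorem Matrix.IsHermitian.posDef_of_sphere {ι : Type*} [Fintype ι] {A : Matrix ι ι ℂ}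
    (hA : A.IsHermitian)
    (h : ∀ z ∈ Metric.sphere (0 : ι → ℂ) 1, 0 < (star z ⬝ᵥ (A *ᵥ z)).re) : A.PosDef := by
  refine .of_dotProduct_mulVec_pos hA fun x hx => ?_
  have hx' : 0 < ‖x‖ := norm_pos_iff.2 hx
  have hz := h ((‖x‖⁻¹ : ℝ) • x) (by simp [norm_smul, hx'.ne'])
  rw [mulVec_smul, star_smul, smul_dotProduct, dotProduct_smul, Complex.smul_re,
    Complex.smul_re] at hz
  have hre : 0 < (star x ⬝ᵥ (A *ᵥ x)).re := by
    simp only [star_trivial, smul_eq_mul] at hz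
    exact pos_of_mul_pos_right (pos_of_mul_pos_right hz (by positivity)) (by positivity)
  exact Complex.pos_iff.2 ⟨hre, (hA.im_star_dotProduct_mulVec_self x).symm⟩

open Topology in
/-- Positive definiteness is an open condition among Hermitian matrices. -/
theorem Matrix.PosDef.eventually_posDef {ι : Type*} [Fintype ι] {A : Matrix ι ι ℂ}
    (hA : A.PosDef) : ∀ᶠ B in 𝓝 A, B.IsHermitian → B.PosDef := by
  have hcont : Continuous fun q : Matrix ι ι ℂ × (ι → ℂ) =>
      (star q.2 ⬝ᵥ (q.1 *ᵥ q.2)).re := by fun_prop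
  have hev := (isCompact_sphere (0 : ι → ℂ) 1).eventually_forall_of_forall_eventually
    (x₀ := A) (P := fun B z => 0 < (star z ⬝ᵥ (B *ᵥ z)).re) fun z hz => by
      refine hcont.continuousAt.eventually (lt_mem_nhds ?_)
      exact (Complex.pos_iff.1 (hA.dotProduct_mulVec_pos
        (ne_zero_of_mem_unit_sphere ⟨z, hz⟩))).1
  exact hev.mono fun B hB hBh => hBh.posDef_of_sphere hB

/-- **Parameter-dependent LMI, existence of a continuous solution.**
If `D` is a compact topological space, `L : D × ℝˡ → HMₙ` is continuous,
Hermitian-valued, affine in its second argument, and the strict LMI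
`L(p, h) ≻ 0` is feasible for every `p ∈ D`, then there is a continuous
`h : D → ℝˡ` with `L(p, h(p)) ≻ 0` for all `p`. -/
theorem parameter_dependent_LMI_continuous_solution
    {D : Type*} [TopologicalSpace D] [CompactSpace D]
    (n l : ℕ) (L : D → (Fin l → ℝ) → Matrix (Fin n) (Fin n) ℂ)
    (hherm : ∀ p h, (L p h).IsHermitian)
    (hcont : Continuous fun ph : D × (Fin l → ℝ) => L ph.1 ph.2)
    (haff : ∀ (p : D) (h₁ h₂ : Fin l → ℝ) (t : ℝ),
      L p (t • h₁ + (1 - t) • h₂) = t • L p h₁ + (1 - t) • L p h₂)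
    (hfeas : ∀ p : D, ∃ h : Fin l → ℝ, (L p h).PosDef) :
    ∃ h : C(D, Fin l → ℝ), ∀ p : D, (L p (h p)).PosDef := by
  let K := Set.range L
  have hL : Continuous L :=
    continuous_pi fun h => hcont.comp (continuous_id.prodMk continuous_const)
  have : CompactSpace K := isCompact_iff_compactSpace.1 (isCompact_range hL)
  obtain ⟨g, hg⟩ := exists_continuous_forall_mem_convex_of_local_const
    (X := K) (t := fun F => {h : Fin l → ℝ | (F.1 h).PosDef})
    (by
      rintro ⟨_, p, rfl⟩ h₁ hh₁ h₂ hh₂ a b ha hb hab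
      obtain rfl : b = 1 - a := by linarith
      simp only [Set.mem_ofPred_eq] at hh₁ hh₂ ⊢
      rw [haff]
      rcases ha.eq_or_lt with rfl | ha
      · simpa using hh₂
      rcases hb.eq_or_lt with hb | hb
      · obtain rfl : a = 1 := by linarith
        simpa using hh₁
      · exact (hh₁.smul ha).add (hh₂.smul hb))
    (by
      rintro ⟨_, p, rfl⟩
      obtain ⟨h, hh⟩ := hfeas p
      have hev : Continuous fun F : K => F.1 h := (continuous_apply h).comp continuous_subtype_val
      refine ⟨h, (hev.continuousAt.eventually hh.eventually_posDef).mono ?_⟩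
      rintro ⟨_, q, rfl⟩ hq
      exact hq (hherm q h))
  exact ⟨g.comp ⟨fun p => ⟨L p, p, rfl⟩, hL.subtype_mk _⟩, fun p => hg ⟨L p, p, rfl⟩⟩
end

section
/- Let D be a compact topological space and let L : D × ℝ^l → HM_n be continuous and such that for each fixed p ∈ D the map h ↦ L(p, h) is affine, and suppose that for every p ∈ D there exists h ∈ ℝ^l with L(p, h) ≻ 0. If F is a dense subset of C(D, ℝ^l), then there exists h ∈ F such that L(p, h(p)) ≻ 0 for all p ∈ D. -/
open Matrix ComplexOrder

/-- The complex matrices whose quadratic form has positive real part on the unit sphere. -/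
def realPartPosMatrices (n : ℕ) : Set (Matrix (Fin n) (Fin n) ℂ) :=
  {M | ∀ x ∈ Metric.sphere (0 : Fin n → ℂ) 1, 0 < (star x ⬝ᵥ (M *ᵥ x)).re}

theorem isOpen_realPartPosMatrices (n : ℕ) : IsOpen (realPartPosMatrices n) := by
  rw [isOpen_iff_eventually]
  intro M hM
  refine (isCompact_sphere (0 : Fin n → ℂ) 1).eventually_forall_of_forall_eventually
    (P := fun M x => 0 < (star x ⬝ᵥ (M *ᵥ x)).re) fun x hx => ?_
  have hc : Continuous fun z : Matrix (Fin n) (Fin n) ℂ × (Fin n → ℂ) =>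
      (star z.2 ⬝ᵥ (z.1 *ᵥ z.2)).re := by
    fun_prop
  exact hc.continuousAt.eventually (lt_mem_nhds (hM x hx))

theorem Matrix.IsHermitian.posDef_iff_mem_realPartPosMatrices {n : ℕ}
    {M : Matrix (Fin n) (Fin n) ℂ} (hM : M.IsHermitian) :
    M.PosDef ↔ M ∈ realPartPosMatrices n := by
  constructor
  · intro h x hx
    have hx0 : x ≠ 0 := by
      rintro rfl
      simp at hx
    exact (Complex.pos_iff.1 (h.dotProduct_mulVec_pos hx0)).1
  · intro h
    refine PosDef.of_dotProduct_mulVec_pos hM fun x hx => ?_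
    have hx' : 0 < ‖x‖ := norm_pos_iff.2 hx
    refine Complex.pos_iff.2 ⟨?_, (hM.im_star_dotProduct_mulVec_self x).symm⟩
    have hs := h ((‖x‖⁻¹ : ℝ) • x) (by simp [norm_smul, hx'.ne'])
    rw [star_smul, mulVec_smul, smul_dotProduct, dotProduct_smul, smul_smul,
      Complex.smul_re, smul_eq_mul] at hs
    exact pos_of_mul_pos_right hs (by simp only [star_trivial]; positivity)

/-- A pointwise feasible, continuous, affine family of matrix inequalities over a compact space has a continuous solution. -/
theorem exists_continuousMap_forall_posDef {D : Type*} [TopologicalSpace D] [CompactSpace D]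
    (n l : ℕ) (L : D → (Fin l → ℝ) → Matrix (Fin n) (Fin n) ℂ)
    (hherm : ∀ p h, (L p h).IsHermitian)
    (hcont : Continuous fun ph : D × (Fin l → ℝ) => L ph.1 ph.2)
    (haff : ∀ (p : D) (h₁ h₂ : Fin l → ℝ) (t : ℝ),
      L p (t • h₁ + (1 - t) • h₂) = t • L p h₁ + (1 - t) • L p h₂)
    (hfeas : ∀ p : D, ∃ h : Fin l → ℝ, (L p h).PosDef) :
    ∃ g : C(D, Fin l → ℝ), ∀ p, (L p (g p)).PosDef := by
  -- `D` need not be normal, so the selection is made on its compact Hausdorff image.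
  let φ : C(D, C(Fin l → ℝ, Fin n → Fin n → ℂ)) :=
    ContinuousMap.curry ⟨fun ph => L ph.1 ph.2, hcont⟩
  have hφ : ∀ p h, φ p h = L p h := fun _ _ => rfl
  clear_value φ
  have hcomp : CompactSpace (Set.range φ) := isCompact_iff_compactSpace.1
    (isCompact_range φ.continuous)
  let t : Set.range φ → Set (Fin l → ℝ) := fun x => {h | PosDef (x.1 h : Matrix (Fin n) (Fin n) ℂ)}
  have ht : ∀ p h, h ∈ t ⟨φ p, p, rfl⟩ ↔ (L p h).PosDef := fun p h => by
    rw [← hφ]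
    rfl
  have hconv : ∀ x, Convex ℝ (t x) := by
    rintro ⟨_, p, rfl⟩ h₁ hh₁ h₂ hh₂ a b ha hb hab
    rw [ht] at hh₁ hh₂ ⊢
    obtain rfl : b = 1 - a := by linarith
    rw [haff]
    rcases ha.eq_or_lt with rfl | ha
    · simpa using hh₂
    rcases hb.eq_or_lt with hb | hb
    · rw [← hb, zero_smul, add_zero]
      exact hh₁.smul ha
    · exact (hh₁.smul ha).add (hh₂.smul hb)
  have hlocal : ∀ x, ∃ h, ∀ᶠ y in nhds x, h ∈ t y := by
    rintro ⟨_, p, rfl⟩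
    obtain ⟨h, hh⟩ := hfeas p
    refine ⟨h, ?_⟩
    have hc : Continuous fun x : Set.range φ => (x.1 h : Fin n → Fin n → ℂ) :=
      (continuous_eval_const h).comp continuous_subtype_val
    have hmem : φ p h ∈ realPartPosMatrices n := by
      rw [hφ]
      exact (hherm p h).posDef_iff_mem_realPartPosMatrices.1 hh
    filter_upwards [hc.continuousAt.eventually ((isOpen_realPartPosMatrices n).mem_nhds hmem)]
    rintro ⟨_, q, rfl⟩ hq
    rw [hφ] at hq
    exact (ht q h).2 ((hherm q h).posDef_iff_mem_realPartPosMatrices.2 hq)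
  obtain ⟨g, hg⟩ := exists_continuous_forall_mem_convex_of_local_const hconv hlocal
  exact ⟨g.comp ⟨Set.rangeFactorization φ, φ.continuous.subtype_mk _⟩,
    fun p => (ht p _).1 (hg ⟨φ p, p, rfl⟩)⟩

/-- **Solutions of a feasible parameter-dependent LMI in a dense subset.**
For `D` compact and `L : D × ℝˡ → HMₙ` continuous, Hermitian-valued, affine in the
second argument, and pointwise feasible, any dense subset `F` of `C(D, ℝˡ)` contains a
continuous solution `h` with `L(p, h(p)) ≻ 0` for all `p`. -/
theorem parameter_dependent_LMI_solution_in_dense_subset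
    {D : Type*} [TopologicalSpace D] [CompactSpace D]
    (n l : ℕ) (L : D → (Fin l → ℝ) → Matrix (Fin n) (Fin n) ℂ)
    (hherm : ∀ p h, (L p h).IsHermitian)
    (hcont : Continuous fun ph : D × (Fin l → ℝ) => L ph.1 ph.2)
    (haff : ∀ (p : D) (h₁ h₂ : Fin l → ℝ) (t : ℝ),
      L p (t • h₁ + (1 - t) • h₂) = t • L p h₁ + (1 - t) • L p h₂)
    (hfeas : ∀ p : D, ∃ h : Fin l → ℝ, (L p h).PosDef)
    (F : Set C(D, Fin l → ℝ)) (hF : Dense F) :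
    ∃ h ∈ F, ∀ p : D, (L p (h p)).PosDef := by
  obtain ⟨g, hg⟩ := exists_continuousMap_forall_posDef n l L hherm hcont haff hfeas
  have hc : Continuous fun vp : (Fin l → ℝ) × D => L vp.2 (g vp.2 + vp.1) :=
    hcont.comp (continuous_snd.prodMk ((g.continuous.comp continuous_snd).add continuous_fst))
  have hev : ∀ᶠ v in nhds (0 : Fin l → ℝ), ∀ p ∈ Set.univ,
      L p (g p + v) ∈ realPartPosMatrices n :=
    isCompact_univ.eventually_forall_of_forall_eventually fun p _ =>
      hc.continuousAt.eventually ((isOpen_realPartPosMatrices n).mem_nhds (by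
        simpa using (hherm p (g p)).posDef_iff_mem_realPartPosMatrices.1 (hg p)))
  obtain ⟨ε, hε, hball⟩ := Metric.eventually_nhds_iff.1 hev
  obtain ⟨h, hhF, hh⟩ := hF.exists_dist_lt g hε
  refine ⟨h, hhF, fun p => (hherm p (h p)).posDef_iff_mem_realPartPosMatrices.2 ?_⟩
  have hdist : dist (h p - g p) 0 < ε := by
    rw [dist_zero_right, ← dist_eq_norm, dist_comm]
    exact (ContinuousMap.dist_apply_le_dist p).trans_lt hh
  simpa using hball hdist p (Set.mem_univ p)
end

section
/- Let D be a compact subset of ℝ^k and let L : D × ℝ^l → HM_n be continuous and such that for each fixed p ∈ D the map h ↦ L(p, h) is affine, and suppose that for every p ∈ D there exists h ∈ ℝ^l with L(p, h) ≻ 0. Then there exist real polynomials h₁, …, h_l in the k variables p₁, …, p_k such that L(p, (h₁(p), …, h_l(p))) ≻ 0 for all p ∈ D. -/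
open Matrix ComplexOrder

open Filter Topology in
theorem eventually_posDef_of_continuous {X : Type*} [TopologicalSpace X] {n : ℕ}
    {M : X → Matrix (Fin n) (Fin n) ℂ} (hM : Continuous M) (hherm : ∀ x, (M x).IsHermitian)
    {x : X} (hx : (M x).PosDef) : ∀ᶠ y in 𝓝 x, (M y).PosDef := by
  have hq : Continuous fun yz : X × (Fin n → ℂ) =>
      (star yz.2 ⬝ᵥ (M yz.1 *ᵥ yz.2)).re := by fun_prop
  have hev : ∀ᶠ y in 𝓝 x, ∀ z ∈ Metric.sphere (0 : Fin n → ℂ) 1,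
      0 < (star z ⬝ᵥ (M y *ᵥ z)).re := by
    refine (isCompact_sphere _ _).eventually_forall_of_forall_eventually fun z hz => ?_
    exact hq.continuousAt.eventually_const_lt
      (hx.re_dotProduct_pos (ne_zero_of_mem_unit_sphere ⟨z, hz⟩))
  filter_upwards [hev] with y hy
  refine PosDef.of_dotProduct_mulVec_pos (hherm y) fun {z} hz => ?_
  have hz' : 0 < ‖z‖ := norm_pos_iff.mpr hz
  rw [Complex.pos_iff]
  refine ⟨?_, ((hherm y).im_star_dotProduct_mulVec_self z).symm⟩
  have h := hy ((‖z‖⁻¹ : ℝ) • z) (by simp [norm_smul, hz'.ne'])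
  simp only [star_smul, mulVec_smul, smul_dotProduct, dotProduct_smul, Complex.smul_re,
    smul_eq_mul, star_trivial] at h
  have hinv : 0 < ‖z‖⁻¹ := inv_pos.mpr hz'
  exact (mul_pos_iff_of_pos_left hinv).mp ((mul_pos_iff_of_pos_left hinv).mp h)

theorem exists_mvPolynomial_near_continuousMap {k l : ℕ} {D : Set (Fin k → ℝ)} (hD : IsCompact D)
    (g : C(D, Fin l → ℝ)) {ε : ℝ} (hε : 0 < ε) :
    ∃ h : Fin l → MvPolynomial (Fin k) ℝ,
      ∀ p : D, ‖(fun i => MvPolynomial.eval (p : Fin k → ℝ) (h i)) - g p‖ < ε := by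
  have : CompactSpace D := isCompact_iff_compactSpace.mp hD
  let coord : Fin k → C(D, ℝ) := fun j => ⟨fun p => (p : Fin k → ℝ) j,
    (continuous_apply j).comp continuous_subtype_val⟩
  let Φ : MvPolynomial (Fin k) ℝ →ₐ[ℝ] C(D, ℝ) := MvPolynomial.aeval coord
  have hΦ (P : MvPolynomial (Fin k) ℝ) (p : D) : Φ P p = MvPolynomial.eval (p : Fin k → ℝ) P := by
    induction P using MvPolynomial.induction_on with
    | C a => simp [Φ]
    | add P Q hP hQ => simp [hP, hQ]
    | mul_X P j hP => simp [hP]; simp [Φ, coord]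
  have hsep : Φ.range.SeparatesPoints := by
    intro p q hpq
    obtain ⟨j, hj⟩ := Function.ne_iff.mp (Subtype.coe_ne_coe.mpr hpq)
    exact ⟨Φ (MvPolynomial.X j), ⟨_, ⟨_, rfl⟩, rfl⟩, by simpa [hΦ] using hj⟩
  have happrox (i : Fin l) : ∃ P : MvPolynomial (Fin k) ℝ,
      ∀ p : D, ‖MvPolynomial.eval (p : Fin k → ℝ) P - g p i‖ < ε := by
    obtain ⟨⟨_, P, rfl⟩, hP⟩ :=
      ContinuousMap.exists_mem_subalgebra_near_continuous_of_separatesPoints Φ.range hsep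
        (fun p => g p i) (by fun_prop) ε hε
    exact ⟨P, fun p => hΦ P p ▸ hP p⟩
  choose h hh using happrox
  exact ⟨h, fun p => (pi_norm_lt_iff hε).mpr fun i => hh i p⟩

/-- **Polynomial solutions of a parameter-dependent LMI on a compact subset of `ℝᵏ`.**
If `D ⊆ ℝᵏ` is compact and `L : D × ℝˡ → HMₙ` is continuous, Hermitian-valued, affine in
the second argument and pointwise feasible on `D`, then there is a solution of the LMI
whose components are real polynomials in the parameters `p₁, …, p_k`. -/
theorem parameter_dependent_LMI_polynomial_solution
    (k n l : ℕ) (D : Set (Fin k → ℝ)) (hD : IsCompact D)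
    (L : (Fin k → ℝ) → (Fin l → ℝ) → Matrix (Fin n) (Fin n) ℂ)
    (hherm : ∀ p ∈ D, ∀ h : Fin l → ℝ, (L p h).IsHermitian)
    (hcont : ContinuousOn (fun ph : (Fin k → ℝ) × (Fin l → ℝ) => L ph.1 ph.2)
      (D ×ˢ Set.univ))
    (haff : ∀ p ∈ D, ∀ (h₁ h₂ : Fin l → ℝ) (t : ℝ),
      L p (t • h₁ + (1 - t) • h₂) = t • L p h₁ + (1 - t) • L p h₂)
    (hfeas : ∀ p ∈ D, ∃ h : Fin l → ℝ, (L p h).PosDef) :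
    ∃ h : Fin l → MvPolynomial (Fin k) ℝ,
      ∀ p ∈ D, (L p fun i => MvPolynomial.eval p (h i)).PosDef := by
  have : CompactSpace D := isCompact_iff_compactSpace.mp hD
  let M : D × (Fin l → ℝ) → Matrix (Fin n) (Fin n) ℂ := fun q => L q.1 q.2
  have hM : Continuous M :=
    hcont.comp_continuous (f := fun q : D × (Fin l → ℝ) => ((q.1 : Fin k → ℝ), q.2))
      (by fun_prop) fun q => ⟨q.1.2, Set.mem_univ _⟩
  have hopen {q : D × (Fin l → ℝ)} (hq : (M q).PosDef) : ∀ᶠ r in nhds q, (M r).PosDef :=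
    eventually_posDef_of_continuous hM (fun q => hherm q.1 q.1.2 q.2) hq
  have hconv (p : D) : Convex ℝ {h | (M (p, h)).PosDef} := by
    refine convex_iff_forall_pos.mpr fun h₁ hh₁ h₂ hh₂ a b ha hb hab => ?_
    obtain rfl : b = 1 - a := by linarith
    change (L p (a • h₁ + (1 - a) • h₂)).PosDef
    rw [haff p p.2]
    exact (PosDef.smul hh₁ ha).add (PosDef.smul hh₂ hb)
  obtain ⟨g, hg⟩ := exists_continuous_forall_mem_convex_of_local_const hconv fun p => by
    obtain ⟨h, hh⟩ := hfeas p p.2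
    exact ⟨h, (Continuous.prodMk_left h).continuousAt.eventually (hopen (q := (p, h)) hh)⟩
  have hnear : ∀ᶠ δ in nhds (0 : Fin l → ℝ), ∀ p ∈ (Set.univ : Set D),
      (M (p, g p + δ)).PosDef := by
    refine isCompact_univ.eventually_forall_of_forall_eventually fun p _ => ?_
    have hc : Continuous fun z : (Fin l → ℝ) × D => (z.2, g z.2 + z.1) := by fun_prop
    exact hc.continuousAt.eventually (hopen (by simpa using hg p))
  obtain ⟨ε, hε, hball⟩ := Metric.eventually_nhds_iff.mp hnear
  obtain ⟨h, hh⟩ := exists_mvPolynomial_near_continuousMap hD g hε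
  refine ⟨h, fun p hp => ?_⟩
  have := hball (by simpa using hh ⟨p, hp⟩) ⟨p, hp⟩ (Set.mem_univ _)
  simpa only [add_sub_cancel] using this
end

section
/- Let D be a compact topological space, let K be a closed convex cone in ℝ^l that is pointed (K ∩ (−K) = {0}) and has nonempty interior, and let K⁺ = { z ∈ ℝ^l : ⟨z, y⟩ ≥ 0 for all y ∈ K } be its dual cone. Let Q₀, Q₁, …, Q_l : D → HM_n be continuous, and set F₀(p, x) = x*Q₀(p)x ∈ ℝ and F(p, x) = (x*Q₁(p)x, …, x*Q_l(p)x) ∈ ℝ^l. Suppose that for every p ∈ D there exists a vector h_p ∈ K⁺ such that F₀(p, x) > ⟨h_p, F(p, x)⟩ for all nonzero x ∈ ℂ^n. Then there exists a continuous function h : D → ℝ^l with h(p) ∈ K⁺ for all p ∈ D such that F₀(p, x) > ⟨h(p), F(p, x)⟩ for all p ∈ D and all nonzero x ∈ ℂ^n. -/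
open Matrix

open Topology in
/-- Strict domination of one form by a fixed combination of others is an open condition
on the coefficient matrices. -/
theorem eventually_forall_ne_zero_sum_mul_re_lt {n l : ℕ} (h : Fin l → ℝ)
    (M : Matrix (Fin n) (Fin n) ℂ × (Fin l → Matrix (Fin n) (Fin n) ℂ))
    (hM : ∀ x : Fin n → ℂ, x ≠ 0 →
      (star x ⬝ᵥ M.1 *ᵥ x).re > ∑ i, h i * (star x ⬝ᵥ (M.2 i) *ᵥ x).re) :
    ∀ᶠ N in 𝓝 M, ∀ x : Fin n → ℂ, x ≠ 0 →
      (star x ⬝ᵥ N.1 *ᵥ x).re > ∑ i, h i * (star x ⬝ᵥ (N.2 i) *ᵥ x).re := by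
  have hsphere : ∀ᶠ N in 𝓝 M, ∀ x ∈ Metric.sphere (0 : Fin n → ℂ) 1,
      (star x ⬝ᵥ N.1 *ᵥ x).re > ∑ i, h i * (star x ⬝ᵥ (N.2 i) *ᵥ x).re := by
    refine (isCompact_sphere _ _).eventually_forall_of_forall_eventually fun x hx => ?_
    refine ContinuousAt.eventually_lt (Continuous.continuousAt ?_) (Continuous.continuousAt ?_)
      (hM x (ne_zero_of_mem_unit_sphere ⟨x, hx⟩))
    · refine continuous_finsetSum _ fun i _ => continuous_const.mul ?_
      exact Complex.continuous_re.comp (continuous_snd.star.dotProduct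
        (((continuous_apply i).comp (continuous_snd.comp continuous_fst)).matrix_mulVec
          continuous_snd))
    · exact Complex.continuous_re.comp (continuous_snd.star.dotProduct
        ((continuous_fst.comp continuous_fst).matrix_mulVec continuous_snd))
  filter_upwards [hsphere] with N hN x hx
  have hpos : 0 < ‖x‖ := norm_pos_iff.mpr hx
  have hscale : ∀ A : Matrix (Fin n) (Fin n) ℂ,
      (star (‖x‖⁻¹ • x) ⬝ᵥ A *ᵥ (‖x‖⁻¹ • x)).re =
        (‖x‖⁻¹ * ‖x‖⁻¹) * (star x ⬝ᵥ A *ᵥ x).re := fun A => by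
    simp only [star_smul, star_trivial, mulVec_smul, smul_dotProduct, dotProduct_smul,
      Complex.real_smul, Complex.re_ofReal_mul, mul_assoc]
  have hx' := hN (‖x‖⁻¹ • x) (by simp [norm_smul, hpos.ne'])
  simp only [hscale, mul_left_comm (h _), ← Finset.mul_sum] at hx'
  exact lt_of_mul_lt_mul_left hx' (by positivity)

/-- The multipliers that lie in the dual of `K` and certify strict domination form a convex set. -/
theorem convex_setOf_dual_sum_mul_re_lt {n l : ℕ} (K : Set (Fin l → ℝ))
    (M : Matrix (Fin n) (Fin n) ℂ × (Fin l → Matrix (Fin n) (Fin n) ℂ)) :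
    Convex ℝ {h : Fin l → ℝ | (∀ y ∈ K, 0 ≤ ∑ i, h i * y i) ∧ ∀ x : Fin n → ℂ, x ≠ 0 →
      (star x ⬝ᵥ M.1 *ᵥ x).re > ∑ i, h i * (star x ⬝ᵥ (M.2 i) *ᵥ x).re} := by
  have hlin : ∀ y : Fin l → ℝ, IsLinearMap ℝ fun h : Fin l → ℝ => ∑ i, h i * y i := fun y =>
    ⟨fun a b => by simp [add_mul, Finset.sum_add_distrib],
      fun c a => by simp [mul_assoc, Finset.mul_sum]⟩
  simp only [Set.ofPred_and, Set.ofPred_forall]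
  exact (convex_iInter₂ fun y _ => convex_halfSpace_ge (hlin y) 0).inter
    (convex_iInter₂ fun x _ => convex_halfSpace_lt (hlin _) _)

/-- **Parameter-dependent S-procedure: continuity of the Lagrange multipliers.**
Let `D` be compact, `K ⊆ ℝˡ` a closed convex pointed cone with nonempty interior and
`K⁺` its dual cone.  Given continuous Hermitian-matrix-valued maps `Q₀, Q₁, …, Q_l` on
`D` defining the quadratic forms `F₀(p,x) = x*Q₀(p)x` and
`F(p,x) = (x*Q₁(p)x, …, x*Q_l(p)x)`, if for every `p` there is a multiplier
`h_p ∈ K⁺` with `F₀(p,x) > ⟨h_p, F(p,x)⟩` for all `x ≠ 0`, then the multiplier can be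
chosen to depend continuously on `p`. -/
theorem parameter_dependent_S_procedure_continuous_multiplier
    {D : Type*} [TopologicalSpace D] [CompactSpace D]
    (n l : ℕ) (K : Set (Fin l → ℝ))
    (hKclosed : IsClosed K) (hKconvex : Convex ℝ K)
    (hKcone : ∀ x ∈ K, ∀ c : ℝ, 0 ≤ c → c • x ∈ K)
    (hKpointed : K ∩ (-K) = {0})
    (hKint : (interior K).Nonempty)
    (Q₀ : D → Matrix (Fin n) (Fin n) ℂ) (Q : Fin l → D → Matrix (Fin n) (Fin n) ℂ)
    (hQ₀herm : ∀ p, (Q₀ p).IsHermitian) (hQherm : ∀ i p, (Q i p).IsHermitian)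
    (hQ₀cont : Continuous Q₀) (hQcont : ∀ i, Continuous (Q i))
    (hfeas : ∀ p : D, ∃ hp : Fin l → ℝ,
      (∀ y ∈ K, 0 ≤ ∑ i, hp i * y i) ∧
      ∀ x : Fin n → ℂ, x ≠ 0 →
        (star x ⬝ᵥ (Q₀ p) *ᵥ x).re > ∑ i, hp i * (star x ⬝ᵥ (Q i p) *ᵥ x).re) :
    ∃ h : C(D, Fin l → ℝ),
      (∀ p : D, ∀ y ∈ K, 0 ≤ ∑ i, h p i * y i) ∧
      ∀ p : D, ∀ x : Fin n → ℂ, x ≠ 0 →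
        (star x ⬝ᵥ (Q₀ p) *ᵥ x).re > ∑ i, h p i * (star x ⬝ᵥ (Q i p) *ᵥ x).re := by
  let E := Matrix (Fin n) (Fin n) ℂ × (Fin l → Matrix (Fin n) (Fin n) ℂ)
  let multipliers : E → Set (Fin l → ℝ) := fun M =>
    {h | (∀ y ∈ K, 0 ≤ ∑ i, h i * y i) ∧ ∀ x : Fin n → ℂ, x ≠ 0 →
      (star x ⬝ᵥ M.1 *ᵥ x).re > ∑ i, h i * (star x ⬝ᵥ (M.2 i) *ᵥ x).re}
  -- `D` need not be normal, so the selection is made on the metrizable space of coefficients.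
  let X := {M : E // (multipliers M).Nonempty}
  have : TopologicalSpace.PseudoMetrizableSpace (Matrix (Fin n) (Fin n) ℂ) :=
    inferInstanceAs (TopologicalSpace.PseudoMetrizableSpace (Fin n → Fin n → ℂ))
  have : TopologicalSpace.PseudoMetrizableSpace E :=
    inferInstanceAs (TopologicalSpace.PseudoMetrizableSpace
      (Matrix (Fin n) (Fin n) ℂ × (Fin l → Matrix (Fin n) (Fin n) ℂ)))
  have : TopologicalSpace.PseudoMetrizableSpace X :=
    Topology.IsInducing.subtypeVal.pseudoMetrizableSpace
  let := TopologicalSpace.pseudoMetrizableSpacePseudoMetric X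
  obtain ⟨g, hg⟩ := exists_continuous_forall_mem_convex_of_local_const
    (X := X) (t := fun M => multipliers M.1)
    (fun M => convex_setOf_dual_sum_mul_re_lt K M.1) fun ⟨M, h, hK, hM⟩ =>
      ⟨h, (continuous_subtype_val.continuousAt.eventually
        (eventually_forall_ne_zero_sum_mul_re_lt h M hM)).mono fun _ hN => ⟨hK, hN⟩⟩
  let q : C(D, X) := ⟨fun p => ⟨(Q₀ p, fun i => Q i p), hfeas p⟩,
    (hQ₀cont.prodMk (continuous_pi hQcont)).subtype_mk _⟩
  exact ⟨g.comp q, fun p => (hg (q p)).1, fun p => (hg (q p)).2⟩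
end

section
/- (Yakubovich Lemma.) Let A ∈ ℂ^{n_x×n_x}, B ∈ ℂ^{n_x×n_u}, and let G be a Hermitian (n_x+n_u)×(n_x+n_u) matrix. The following are equivalent: (1) for all x ∈ ℂ^{n_x} and u ∈ ℂ^{n_u} with (x, u) ≠ 0, if x = 0 or there exists ω ∈ ℝ with iωx = Ax + Bu, then (x, u)* G (x, u) > 0; (2) there exists a Hermitian n_x×n_x matrix H such that G ≻ [[HA + A*H, HB], [B*H, 0]], where the right-hand side is the Hermitian block matrix with blocks HA + A*H, HB, B*H, and 0. -/
open Matrix ComplexOrder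

section Pencil

variable {E F : Type*} [NormedAddCommGroup E] [InnerProductSpace ℂ E] [FiniteDimensional ℂ E]
  [NormedAddCommGroup F] [InnerProductSpace ℂ F] [FiniteDimensional ℂ F]

/-- If `X Y†` is skew-adjoint, then on the range of `X†` the map `Y` factors as `X T` with
`-i T` symmetric. -/
theorem exists_isSymmetric_comp_eq (X Y : E →ₗ[ℂ] F)
    (h : ∀ p, X (Y.adjoint p) = -Y (X.adjoint p)) :
    ∃ S : X.adjoint.range →ₗ[ℂ] X.adjoint.range, S.IsSymmetric ∧
      ∀ v : X.adjoint.range, Y v = Complex.I • X (S v) := by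
  set V := X.adjoint.range with hV
  have hker : V = X.kerᗮ := (LinearMap.orthogonal_ker X).symm
  have hinj : LinearMap.ker (X ∘ₗ V.subtype) = ⊥ := by
    rw [LinearMap.ker_eq_bot']
    rintro ⟨v, hv⟩ hXv
    have h1 : v ∈ X.ker := hXv
    have h2 : v ∈ X.kerᗮ := hker ▸ hv
    have : v = 0 := by
      have := (Submodule.mem_orthogonal _ _).1 h2 v h1
      simpa using this
    simpa using this
  obtain ⟨g, hg⟩ := LinearMap.exists_leftInverse_of_injective _ hinj
  have hgX : ∀ s : V, g (X s) = s := fun s => LinearMap.congr_fun hg s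
  have hXg : ∀ v : V, X (g (Y v)) = Y v := by
    rintro ⟨_, p, rfl⟩
    have hY : Y (X.adjoint p) = X (-Y.adjoint p) := by rw [map_neg, h, neg_neg]
    obtain ⟨k, hk, s, hs, hks⟩ :=
      Submodule.exists_add_mem_mem_orthogonal (K := X.ker) (-Y.adjoint p)
    rw [← hker] at hs
    have hXs : X (-Y.adjoint p) = X s := by
      rw [hks, map_add, LinearMap.mem_ker.1 hk, zero_add]
    change X (g (Y (X.adjoint p))) = Y (X.adjoint p)
    rw [hY, hXs, hgX ⟨s, hs⟩]
  refine ⟨-Complex.I • (g ∘ₗ Y ∘ₗ V.subtype), ?_, fun v => ?_⟩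
  · have left : ∀ (v : V) (q : F), inner ℂ ((g (Y v) : V) : E) (X.adjoint q) = inner ℂ (Y v) q :=
      fun v q => by rw [LinearMap.adjoint_inner_right, hXg]
    have right : ∀ (v : V) (q : F), inner ℂ (X.adjoint q) ((g (Y v) : V) : E) = inner ℂ q (Y v) :=
      fun v q => by rw [LinearMap.adjoint_inner_left, hXg]
    rintro ⟨_, p, rfl⟩ ⟨_, q, rfl⟩
    have h1 := left ⟨_, p, rfl⟩ q
    have h2 := right ⟨_, q, rfl⟩ p
    have h3 : inner ℂ p (Y (X.adjoint q)) = - inner ℂ (Y (X.adjoint p)) q := by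
      rw [← neg_neg (Y (X.adjoint q)), ← h, inner_neg_right, ← X.adjoint_inner_left,
        Y.adjoint_inner_right]
    simp only [LinearMap.smul_apply, LinearMap.comp_apply, Submodule.subtype_apply,
      inner_smul_left, inner_smul_right, Submodule.coe_inner] at h1 h2 ⊢
    rw [h1, h2, h3]
    simp
  · simp only [LinearMap.smul_apply, LinearMap.comp_apply, Submodule.subtype_apply,
      Submodule.coe_smul, map_smul, hXg, smul_smul]
    simp

theorem exists_orthonormalBasis_eq_zero_or_eq_smul (X Y : E →ₗ[ℂ] F)
    (h : ∀ p, X (Y.adjoint p) = -Y (X.adjoint p)) :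
    ∃ (ι : Type) (_ : Fintype ι) (b : OrthonormalBasis ι ℂ E),
      ∀ k, X (b k) = 0 ∨ ∃ ω : ℝ, Y (b k) = (Complex.I * ω) • X (b k) := by
  obtain ⟨S, hS, hY⟩ := exists_isSymmetric_comp_eq X Y h
  set V := X.adjoint.range with hV
  have hker : Vᗮ = X.ker := by
    rw [hV, ← LinearMap.orthogonal_ker, Submodule.orthogonal_orthogonal]
  let e := hS.eigenvectorBasis rfl
  let f := stdOrthonormalBasis ℂ Vᗮ
  let b : Fin (Module.finrank ℂ V) ⊕ Fin (Module.finrank ℂ Vᗮ) → E :=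
    Sum.elim (fun i => (e i : E)) (fun j => (f j : E))
  have hb : Orthonormal ℂ b := by
    classical
    rw [orthonormal_iff_ite]
    have he := orthonormal_iff_ite.1 e.orthonormal
    have hf := orthonormal_iff_ite.1 f.orthonormal
    rintro (i | i) (j | j)
    · simpa [b] using he i j
    · simpa [b] using (Submodule.mem_orthogonal _ _).1 (f j).2 _ (e i).2
    · simpa [b] using (Submodule.mem_orthogonal' _ _).1 (f i).2 _ (e j).2
    · simpa [b] using hf i j
  have hcard : Fintype.card (Fin (Module.finrank ℂ V) ⊕ Fin (Module.finrank ℂ Vᗮ)) =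
      Module.finrank ℂ E := by
    simpa using Submodule.finrank_add_finrank_orthogonal V
  have hspan : ⊤ ≤ Submodule.span ℂ (Set.range b) :=
    (hb.linearIndependent.span_eq_top_of_card_eq_finrank' hcard).ge
  refine ⟨_, inferInstance, OrthonormalBasis.mk hb hspan, ?_⟩
  rintro (i | j)
  · refine Or.inr ⟨hS.eigenvalues rfl i, ?_⟩
    have := hY (e i)
    rw [hS.apply_eigenvectorBasis, Submodule.coe_smul, map_smul, smul_smul] at this
    simpa only [OrthonormalBasis.coe_mk] using! this
  · left
    have : (f j : E) ∈ X.ker := hker ▸ (f j).2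
    simpa [b] using this

end Pencil

section Separation

variable {n : Type*} [Fintype n]

theorem isOpen_setOf_forall_re_dotProduct_mulVec_pos :
    IsOpen {M : Matrix n n ℂ | ∀ x : n → ℂ, x ≠ 0 → 0 < (star x ⬝ᵥ M *ᵥ x).re} := by
  have key : {M : Matrix n n ℂ | ∀ x : n → ℂ, x ≠ 0 → 0 < (star x ⬝ᵥ M *ᵥ x).re} =
      {M : Matrix n n ℂ | ∀ x ∈ Metric.sphere (0 : n → ℂ) 1, 0 < (star x ⬝ᵥ M *ᵥ x).re} := by
    ext M
    refine ⟨fun h x hx => h x (ne_zero_of_mem_unit_sphere ⟨x, hx⟩), fun h x hx => ?_⟩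
    have hpos : 0 < ‖x‖ := norm_pos_iff.2 hx
    have := h ((‖x‖⁻¹ : ℝ) • x) (by simp [norm_smul, hpos.ne'])
    rw [star_smul, mulVec_smul, dotProduct_smul, smul_dotProduct, smul_smul, Complex.smul_re] at this
    simp only [star_trivial, smul_eq_mul] at this
    exact pos_of_mul_pos_right this (by positivity)
  rw [key, isOpen_iff_eventually]
  intro M hM
  refine (isCompact_sphere (0 : n → ℂ) 1).eventually_forall_of_forall_eventually fun x hx => ?_
  have hc : Continuous fun z : Matrix n n ℂ × (n → ℂ) => (star z.2 ⬝ᵥ z.1 *ᵥ z.2).re :=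
    Complex.continuous_re.comp
      ((continuous_snd.star).dotProduct (continuous_fst.matrix_mulVec continuous_snd))
  exact hc.continuousAt.eventually (lt_mem_nhds (hM x hx))

theorem convex_setOf_forall_re_dotProduct_mulVec_pos :
    Convex ℝ {M : Matrix n n ℂ | ∀ x : n → ℂ, x ≠ 0 → 0 < (star x ⬝ᵥ M *ᵥ x).re} := by
  rw [convex_iff_forall_pos]
  intro M hM N hN a b ha hb _ x hx
  have h1 := hM x hx
  have h2 := hN x hx
  rw [add_mulVec, smul_mulVec, smul_mulVec, dotProduct_add, dotProduct_smul, dotProduct_smul,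
    Complex.add_re, Complex.smul_re, Complex.smul_re, smul_eq_mul, smul_eq_mul]
  positivity

variable [DecidableEq n]

theorem exists_eq_trace_mul (f : Matrix n n ℂ →ₗ[ℂ] ℂ) :
    ∃ Z : Matrix n n ℂ, ∀ M, f M = (Z * M).trace := by
  refine ⟨of fun i j => f (single j i 1), fun M => ?_⟩
  conv_lhs => rw [matrix_eq_sum_single M]
  simp only [map_sum, trace, diag, mul_apply, of_apply]
  rw [Finset.sum_comm]
  refine Finset.sum_congr rfl fun i _ => Finset.sum_congr rfl fun j _ => ?_
  rw [mul_comm, ← smul_eq_mul, ← map_smul, smul_single, smul_eq_mul, mul_one]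

theorem re_trace_add_conjTranspose_mul {Z M : Matrix n n ℂ} (hM : M.IsHermitian) :
    ((Z + Zᴴ) * M).trace.re = 2 * (Z * M).trace.re := by
  have : (Zᴴ * M).trace.re = (Z * M).trace.re := by
    conv_lhs => rw [← hM.eq, ← conjTranspose_mul, trace_conjTranspose, trace_mul_comm]
    simp
  rw [add_mul, trace_add, Complex.add_re, this, two_mul]

/-- If no matrix `G - L h` is positive definite, there is a nonzero
positive semidefinite `Z` annihilating the range of `L` with `tr (Z G) ≤ 0`. -/
theorem exists_posSemidef_of_forall_not_posDef {W : Type*} [AddCommGroup W] [Module ℝ W]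
    (G : Matrix n n ℂ) (hG : G.IsHermitian) (L : W →ₗ[ℝ] Matrix n n ℂ)
    (hL : ∀ h, (L h).IsHermitian) (hn : ∀ h, ¬ (G - L h).PosDef) :
    ∃ Z : Matrix n n ℂ, Z.PosSemidef ∧ Z ≠ 0 ∧ (∀ h, (Z * L h).trace.re = 0) ∧
      (Z * G).trace.re ≤ 0 := by
  set C := {M : Matrix n n ℂ | ∀ x : n → ℂ, x ≠ 0 → 0 < (star x ⬝ᵥ M *ᵥ x).re}
  have hC : ∀ M : Matrix n n ℂ, M.PosDef → M ∈ C :=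
    fun M hM x hx => (Complex.lt_def.1 (hM.dotProduct_mulVec_pos hx)).1
  have hD : Convex ℝ (Set.range fun h => G - L h) := by
    rintro _ ⟨x, rfl⟩ _ ⟨y, rfl⟩ a b _ _ hab
    refine ⟨a • x + b • y, ?_⟩
    simp only [map_add, map_smul, smul_sub]
    nth_rw 1 [← one_smul ℝ G]
    rw [← hab, add_smul]
    abel
  have hdisj : Disjoint C (Set.range fun h => G - L h) := by
    rw [Set.disjoint_left]
    rintro _ hM ⟨h, rfl⟩
    have hherm := hG.sub (hL h)
    refine hn h (PosDef.of_dotProduct_mulVec_pos hherm fun x hx => ?_)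
    rw [Complex.lt_def]
    exact ⟨hM x hx, (hherm.im_star_dotProduct_mulVec_self x).symm⟩
  obtain ⟨f, u, hfC, hfD⟩ := RCLike.geometric_hahn_banach_open (𝕜 := ℂ)
    convex_setOf_forall_re_dotProduct_mulVec_pos isOpen_setOf_forall_re_dotProduct_mulVec_pos
    hD hdisj
  obtain ⟨Z, hZ⟩ := exists_eq_trace_mul f.toLinearMap
  have hZ' : ∀ M, f M = (Z * M).trace := hZ
  simp only [Set.forall_mem_range, hZ', RCLike.re_eq_complex_re] at hfC hfD
  have hone : ∀ t : ℝ, 0 < t → t * (Z * 1).trace.re < u := fun t ht => by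
    have := hfC (t • 1) (hC _ (PosDef.one.smul ht))
    rwa [Matrix.mul_smul, trace_smul, Complex.smul_re, smul_eq_mul] at this
  have hu : 0 ≤ u := by
    by_contra! hu
    have h1 := hone 1 one_pos
    rw [one_mul] at h1
    have hneg : (Z * 1).trace.re < 0 := by linarith
    have := hone (u / (2 * (Z * 1).trace.re)) (div_pos_of_neg_of_neg hu (by linarith))
    rw [div_mul_eq_mul_div, mul_div_mul_right _ _ hneg.ne] at this
    linarith
  have hpsd : ∀ M : Matrix n n ℂ, M.PosSemidef → (Z * M).trace.re ≤ 0 := by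
    intro M hM
    have h1 : ∀ t : ℝ, 0 < t → (Z * 1).trace.re + t * (Z * M).trace.re < u := fun t ht => by
      have := hfC (1 + t • M) (hC _ (PosDef.one.add_posSemidef (hM.smul ht.le)))
      rwa [mul_add, trace_add, Matrix.mul_smul, trace_smul, Complex.add_re, Complex.smul_re,
        smul_eq_mul] at this
    by_contra! hpos
    have h2 := h1 1 one_pos
    have h3 := h1 ((u - (Z * 1).trace.re) / (Z * M).trace.re) (div_pos (by linarith) hpos)
    rw [div_mul_cancel₀ _ hpos.ne'] at h3
    linarith
  have hLz : ∀ h, (Z * L h).trace.re = 0 := by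
    intro h
    by_contra hne
    have := hfD ((((Z * G).trace.re - u + 1) / (Z * L h).trace.re) • h)
    rw [map_smul, mul_sub, trace_sub, Matrix.mul_smul, trace_smul, Complex.sub_re, Complex.smul_re,
      smul_eq_mul, div_mul_cancel₀ _ hne] at this
    linarith
  have hGz : u ≤ (Z * G).trace.re := by simpa using hfD 0
  have hherm : (-(Z + Zᴴ)).IsHermitian := (isHermitian_add_transpose_self Z).neg
  have htr : ∀ M : Matrix n n ℂ, M.IsHermitian →
      (-(Z + Zᴴ) * M).trace.re = -(2 * (Z * M).trace.re) := fun M hM => by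
    rw [neg_mul, trace_neg, Complex.neg_re, re_trace_add_conjTranspose_mul hM]
  refine ⟨-(Z + Zᴴ), ?_, ?_, fun h => ?_, ?_⟩
  · refine PosSemidef.of_dotProduct_mulVec_nonneg hherm fun x => ?_
    rw [Complex.le_def]
    refine ⟨?_, (hherm.im_star_dotProduct_mulVec_self x).symm⟩
    have h1 := hpsd _ (posSemidef_vecMulVec_self_star x)
    have h2 := htr _ (posSemidef_vecMulVec_self_star x).isHermitian
    rw [mul_vecMulVec, trace_vecMulVec, dotProduct_comm] at h2
    rw [h2, Complex.zero_re]
    linarith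
  · intro h0
    have h1 := htr 1 isHermitian_one
    have h2 := htr G hG
    have h3 := hone 1 one_pos
    rw [h0, zero_mul, trace_zero, Complex.zero_re] at h1 h2
    linarith
  · rw [htr _ (hL h), hLz, mul_zero, neg_zero]
  · rw [htr _ hG]
    linarith

end Separation

section FrequencyDomain

variable {m n : Type*} [Fintype m] [Fintype n]

theorem re_star_dotProduct_mulVec_pos_of_posDef_sub {P Q : Matrix m n ℂ} {G : Matrix n n ℂ}
    {H : Matrix m m ℂ} (hG : (G - (Pᴴ * H * Q + Qᴴ * H * P)).PosDef) {w : n → ℂ} (hw : w ≠ 0)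
    (h : P *ᵥ w = 0 ∨ ∃ ω : ℝ, Q *ᵥ w = (Complex.I * ω) • P *ᵥ w) :
    0 < (star w ⬝ᵥ G *ᵥ w).re := by
  have hpos := hG.dotProduct_mulVec_pos hw
  have e1 : star w ⬝ᵥ (Pᴴ * H * Q) *ᵥ w = star (P *ᵥ w) ⬝ᵥ H *ᵥ Q *ᵥ w := by
    rw [star_mulVec, ← dotProduct_mulVec, mulVec_mulVec, mulVec_mulVec, Matrix.mul_assoc]
  have e2 : star w ⬝ᵥ (Qᴴ * H * P) *ᵥ w = star (Q *ᵥ w) ⬝ᵥ H *ᵥ P *ᵥ w := by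
    rw [star_mulVec, ← dotProduct_mulVec, mulVec_mulVec, mulVec_mulVec, Matrix.mul_assoc]
  have hzero : star (P *ᵥ w) ⬝ᵥ H *ᵥ Q *ᵥ w + star (Q *ᵥ w) ⬝ᵥ H *ᵥ P *ᵥ w = 0 := by
    rcases h with h | ⟨ω, h⟩
    · simp [h]
    · rw [h, mulVec_smul, dotProduct_smul, star_smul, smul_dotProduct, ← add_smul]
      simp
  rw [sub_mulVec, add_mulVec, dotProduct_sub, dotProduct_add, e1, e2, hzero, sub_zero] at hpos
  exact (Complex.lt_def.1 hpos).1

variable [DecidableEq m] [DecidableEq n]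

open scoped MatrixOrder in
/-- Strict positivity of a Hermitian form on the vectors of the pencil `(P, Q)` lying over the
extended imaginary axis gives positivity of its pairing with every nonzero positive semidefinite
`Z` satisfying the Lyapunov-type equation `Q Z Pᴴ + P Z Qᴴ = 0`. -/
theorem Matrix.PosSemidef.re_trace_mul_pos {P Q : Matrix m n ℂ} {G Z : Matrix n n ℂ}
    (hG : ∀ w : n → ℂ, w ≠ 0 → (P *ᵥ w = 0 ∨ ∃ ω : ℝ, Q *ᵥ w = (Complex.I * ω) • P *ᵥ w) →
      0 < (star w ⬝ᵥ G *ᵥ w).re)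
    (hZ : Z.PosSemidef) (hZ0 : Z ≠ 0) (h : Q * Z * Pᴴ + P * Z * Qᴴ = 0) :
    0 < (Z * G).trace.re := by
  obtain ⟨V, hV⟩ := CStarAlgebra.nonneg_iff_eq_star_mul_self.mp hZ.nonneg
  obtain ⟨W, rfl⟩ : ∃ W, Wᴴ = V := ⟨Vᴴ, conjTranspose_conjTranspose V⟩
  rw [star_eq_conjTranspose, conjTranspose_conjTranspose] at hV
  obtain ⟨ι, _, b, hb⟩ := exists_orthonormalBasis_eq_zero_or_eq_smul
    (toEuclideanLin (P * W)) (toEuclideanLin (Q * W)) (fun p => by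
      rw [← toEuclideanLin_conjTranspose_eq_adjoint, ← toEuclideanLin_conjTranspose_eq_adjoint,
        eq_neg_iff_add_eq_zero]
      rw [hV] at h
      ext1
      simp only [toLpLin_apply, mulVec_mulVec, conjTranspose_mul, WithLp.ofLp_add,
        WithLp.ofLp_zero, ← add_mulVec]
      rw [← zero_mulVec p.ofLp, ← h]
      simp only [Matrix.mul_assoc, add_comm])
  have hpos : ∀ k, W *ᵥ (b k).ofLp ≠ 0 →
      0 < (star (W *ᵥ (b k).ofLp) ⬝ᵥ G *ᵥ W *ᵥ (b k).ofLp).re := by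
    intro k hk
    refine hG _ hk ?_
    refine (hb k).imp (fun h0 => ?_) (fun ⟨ω, hω⟩ => ⟨ω, ?_⟩)
    · rw [mulVec_mulVec]
      exact congrArg WithLp.ofLp h0
    · rw [mulVec_mulVec, mulVec_mulVec]
      exact congrArg WithLp.ofLp hω
  have htr : (Z * G).trace =
      ∑ k, star (W *ᵥ (b k).ofLp) ⬝ᵥ G *ᵥ W *ᵥ (b k).ofLp := by
    have h1 : (Z * G).trace = LinearMap.trace ℂ _ (toEuclideanLin (Wᴴ * G * W)) := by
      rw [toEuclideanLin_eq_toLin_orthonormal, trace_toLin_eq, hV, Matrix.mul_assoc,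
        trace_mul_comm]
    rw [h1, LinearMap.trace_eq_sum_inner _ b]
    refine Finset.sum_congr rfl fun k _ => ?_
    rw [EuclideanSpace.inner_eq_star_dotProduct, toLpLin_apply, dotProduct_comm, star_mulVec,
      ← dotProduct_mulVec, mulVec_mulVec, mulVec_mulVec, Matrix.mul_assoc]
  rw [htr, Complex.re_sum]
  refine Finset.sum_pos' (fun k _ => ?_) ?_
  · by_cases hk : W *ᵥ (b k).ofLp = 0
    · simp [hk]
    · exact (hpos k hk).le
  · by_contra! hle
    have hW : toEuclideanLin W = 0 := b.toBasis.ext fun k => by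
      by_contra hk
      refine (hle k (Finset.mem_univ k)).not_gt (hpos k fun h0 => hk ?_)
      rw [OrthonormalBasis.coe_toBasis, toLpLin_apply, h0]
      rfl
    rw [map_eq_zero_iff _ (LinearEquiv.injective _)] at hW
    exact hZ0 (by rw [hV, hW, Matrix.zero_mul])

/-- The frequency-domain theorem for a pencil `(P, Q)`. -/
theorem exists_isHermitian_posDef_sub_of_forall_pos (P Q : Matrix m n ℂ) {G : Matrix n n ℂ}
    (hGh : G.IsHermitian)
    (hG : ∀ w : n → ℂ, w ≠ 0 → (P *ᵥ w = 0 ∨ ∃ ω : ℝ, Q *ᵥ w = (Complex.I * ω) • P *ᵥ w) →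
      0 < (star w ⬝ᵥ G *ᵥ w).re) :
    ∃ H : Matrix m m ℂ, H.IsHermitian ∧ (G - (Pᴴ * H * Q + Qᴴ * H * P)).PosDef := by
  by_contra! hcon
  let L : selfAdjoint (Matrix m m ℂ) →ₗ[ℝ] Matrix n n ℂ :=
    { toFun := fun H => Pᴴ * H.1 * Q + Qᴴ * H.1 * P
      map_add' := fun H K => by
        simp only [AddSubgroup.coe_add, Matrix.mul_add, Matrix.add_mul]
        abel
      map_smul' := fun t H => by simp [smul_add] }
  have hL : ∀ H, (L H).IsHermitian := fun H => by
    have hH : (H : Matrix m m ℂ)ᴴ = H := H.2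
    change (Pᴴ * H.1 * Q + Qᴴ * H.1 * P)ᴴ = Pᴴ * H.1 * Q + Qᴴ * H.1 * P
    simp only [conjTranspose_add, conjTranspose_mul, conjTranspose_conjTranspose, hH,
      Matrix.mul_assoc, add_comm]
  obtain ⟨Z, hZ, hZ0, hZL, hZG⟩ :=
    exists_posSemidef_of_forall_not_posDef G hGh L hL fun H => hcon H H.2
  refine hZG.not_gt (hZ.re_trace_mul_pos hG hZ0 ?_)
  set R := Q * Z * Pᴴ + P * Z * Qᴴ with hR
  have hRh : Rᴴ = R := by
    simp only [hR, conjTranspose_add, conjTranspose_mul, conjTranspose_conjTranspose,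
      hZ.isHermitian.eq, Matrix.mul_assoc, add_comm]
  have htr : (Z * L ⟨R, hRh⟩).trace = (Rᴴ * R).trace := by
    change (Z * (Pᴴ * R * Q + Qᴴ * R * P)).trace = _
    have h1 : (Z * (Pᴴ * R * Q)).trace = (Q * Z * Pᴴ * R).trace := by
      rw [← Matrix.mul_assoc, trace_mul_comm]
      simp only [Matrix.mul_assoc]
    have h2 : (Z * (Qᴴ * R * P)).trace = (P * Z * Qᴴ * R).trace := by
      rw [← Matrix.mul_assoc, trace_mul_comm]
      simp only [Matrix.mul_assoc]
    rw [hRh, Matrix.mul_add, trace_add, h1, h2, ← trace_add, ← Matrix.add_mul]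
  refine trace_conjTranspose_mul_self_eq_zero_iff.1 (Complex.ext ?_ ?_)
  · rw [← htr, hZL, Complex.zero_re]
  · exact (Complex.le_def.1 (posSemidef_conjTranspose_mul_self R).trace_nonneg).2.symm

end FrequencyDomain

/-- **Yakubovich Lemma (1962, 1964).**
For `A ∈ ℂ^{n_x×n_x}`, `B ∈ ℂ^{n_x×n_u}` and a Hermitian matrix `G` of size
`n_x + n_u`, the strict frequency-domain inequality `(x,u)*G(x,u) > 0` — required for
all nonzero pairs `(x,u)` with `x = 0` (the frequency `ω = ±∞`) or `iωx = Ax + Bu` for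
some real `ω` — holds if and only if there is a Hermitian `H` with
`G ≻ [[HA + A*H, HB], [B*H, 0]]`. -/
theorem yakubovich_lemma
    (nx nu : ℕ) (A : Matrix (Fin nx) (Fin nx) ℂ) (B : Matrix (Fin nx) (Fin nu) ℂ)
    (G : Matrix (Fin nx ⊕ Fin nu) (Fin nx ⊕ Fin nu) ℂ) (hG : G.IsHermitian) :
    (∀ (x : Fin nx → ℂ) (u : Fin nu → ℂ), ¬(x = 0 ∧ u = 0) →
        (x = 0 ∨ ∃ ω : ℝ, ((Complex.I * ω) • x = A *ᵥ x + B *ᵥ u)) →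
        0 < (star (Sum.elim x u) ⬝ᵥ G *ᵥ Sum.elim x u).re)
      ↔
    (∃ H : Matrix (Fin nx) (Fin nx) ℂ, H.IsHermitian ∧
        (G - fromBlocks (H * A + Aᴴ * H) (H * B) (Bᴴ * H) 0).PosDef) := by
  let P : Matrix (Fin nx) (Fin nx ⊕ Fin nu) ℂ := fromCols 1 0
  let Q : Matrix (Fin nx) (Fin nx ⊕ Fin nu) ℂ := fromCols A B
  have hblocks : ∀ H : Matrix (Fin nx) (Fin nx) ℂ,
      fromBlocks (H * A + Aᴴ * H) (H * B) (Bᴴ * H) 0 = Pᴴ * H * Q + Qᴴ * H * P := fun H => by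
    simp only [P, Q, conjTranspose_fromCols_eq_fromRows_conjTranspose, fromRows_mul,
      mul_fromCols, fromCols_fromRows_eq_fromBlocks, fromBlocks_add]
    simp
  have hP : ∀ x u, P *ᵥ Sum.elim x u = x := fun x u => by simp [P, fromCols_mulVec]
  have hQ : ∀ x u, Q *ᵥ Sum.elim x u = A *ᵥ x + B *ᵥ u := fun x u => by
    simp [Q, fromCols_mulVec]
  have hne : ∀ (x : Fin nx → ℂ) (u : Fin nu → ℂ), Sum.elim x u ≠ 0 ↔ ¬(x = 0 ∧ u = 0) :=
    fun x u => by
      rw [ne_eq, ← Sum.elim_zero_zero, Sum.elim_eq_iff]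
  simp only [hblocks]
  constructor
  · intro h
    refine exists_isHermitian_posDef_sub_of_forall_pos P Q hG fun w hw hPQ => ?_
    obtain ⟨x, u, rfl⟩ : ∃ x u, w = Sum.elim x u := ⟨_, _, (Sum.elim_comp_inl_inr w).symm⟩
    rw [hP, hQ] at hPQ
    exact h x u ((hne x u).1 hw) (hPQ.imp_right fun ⟨ω, hω⟩ => ⟨ω, hω.symm⟩)
  · rintro ⟨H, -, hpos⟩ x u hxu hPQ
    refine re_star_dotProduct_mulVec_pos_of_posDef_sub hpos ((hne x u).2 hxu) ?_
    rw [hP, hQ]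
    exact hPQ.imp_right fun ⟨ω, hω⟩ => ⟨ω, hω.symm⟩
end

section
/- (Yakubovich Lemma for matrix frequency-domain inequality.) Let M, N ∈ ℂ^{n×n_z} with n_z = n + 1, let Θ₁, Θ₂ be 2×2 Hermitian matrices with det Θ₁ < 0 and det Θ₂ < 0, and let G_{ij} ∈ ℂ^{n_z×n_z}, i, j = 1, …, m, with G_{ij} = (G_{ji})*. Suppose Γ_{Θ₁} ∩ Ω_{Θ₂} contains more than one point (there exist two nonzero pairs in ℂ², neither a scalar multiple of the other, each satisfying (α, β)Θ₁(α, β)* = 0 and (α, β)Θ₂(α, β)* ≥ 0), and suppose rank(αN − βM) = n for every nonzero pair (α, β) with (α, β)Θ₁(α, β)* = 0 and (α, β)Θ₂(α, β)* ≥ 0. Then the following are equivalent: (1) for every such nonzero pair (α, β) and every nonzero z ∈ ℂ^{n_z} with (αN − βM)z = 0, the m×m Hermitian matrix with (i, j) entry z*G_{ij}z is positive definite; (2) there exist H₁, H₂ ∈ HM_{mn} with H₂ ≻ 0 such that the m·n_z × m·n_z Hermitian block matrix G with blocks G_{ij} satisfies G ≻ Λ'_{I_m⊗M, I_m⊗N,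 Θ₁}(H₁) + Λ'_{I_m⊗M, I_m⊗N, Θ₂}(H₂). -/
open Matrix ComplexOrder

/-- The value `(α, β) Θ (α, β)*` of the Hermitian form defined by a `2 × 2` Hermitian
matrix `Θ` on the row vector `(α, β)`. -/
noncomputable def hermPairVal (Θ : Matrix (Fin 2) (Fin 2) ℂ) (α β : ℂ) : ℂ :=
  ![α, β] ⬝ᵥ Θ *ᵥ star ![α, β]

/-- The adjoint generalized Lyapunov operator
`Λ'_{M,N,Θ}(H) = θ₁₁ M*HM + θ₂₁ M*HN + θ₁₂ N*HM + θ₂₂ N*HN`. -/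
noncomputable def lyapAdj {k z : Type*} [Fintype k] (M N : Matrix k z ℂ)
    (Θ : Matrix (Fin 2) (Fin 2) ℂ) (H : Matrix k k ℂ) : Matrix z z ℂ :=
  Θ 0 0 • (Mᴴ * H * M) + Θ 1 0 • (Mᴴ * H * N) + Θ 0 1 • (Nᴴ * H * M) + Θ 1 1 • (Nᴴ * H * N)

/-- The Kronecker product `I_m ⊗ M`, a block-diagonal matrix with `m` copies of `M`. -/
noncomputable def idKron {k z : Type*} (m : ℕ) (M : Matrix k z ℂ) :
    Matrix (Fin m × k) (Fin m × z) ℂ :=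
  Matrix.kroneckerMap (· * ·) (1 : Matrix (Fin m) (Fin m) ℂ) M

open scoped InnerProductSpace

section Pencil

variable {H K : Type} [NormedAddCommGroup H] [InnerProductSpace ℂ H] [FiniteDimensional ℂ H]
  [NormedAddCommGroup K] [InnerProductSpace ℂ K] [FiniteDimensional ℂ K]

/-- Orthonormal bases of a subspace and of its orthogonal complement combine to an orthonormal
basis of the whole space. -/
theorem exists_orthonormalBasis_of_orthogonal (W : Submodule ℂ H) (p : H → Prop)
    (h₁ : ∃ (ι : Type) (_ : Fintype ι) (b : OrthonormalBasis ι ℂ W), ∀ k, p (b k))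
    (h₂ : ∃ (ι : Type) (_ : Fintype ι) (b : OrthonormalBasis ι ℂ Wᗮ), ∀ k, p (b k)) :
    ∃ (ι : Type) (_ : Fintype ι) (b : OrthonormalBasis ι ℂ H), ∀ k, p (b k) := by
  obtain ⟨ι₁, _, b₁, hb₁⟩ := h₁
  obtain ⟨ι₂, _, b₂, hb₂⟩ := h₂
  refine ⟨ι₁ ⊕ ι₂, inferInstance, (b₁.prod b₂).map W.orthogonalDecomposition.symm, ?_⟩
  rintro (k | k)
  · have h : ((b₁.prod b₂).map W.orthogonalDecomposition.symm) (Sum.inl k) = b₁ k := by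
      rw [OrthonormalBasis.map_apply, LinearIsometryEquiv.symm_apply_eq]
      simp [Submodule.orthogonalProjectionOnto_orthogonal_apply_eq_zero (b₁ k).2]
    exact h ▸ hb₁ k
  · have h : ((b₁.prod b₂).map W.orthogonalDecomposition.symm) (Sum.inr k) = b₂ k := by
      rw [OrthonormalBasis.map_apply, LinearIsometryEquiv.symm_apply_eq]
      simp [Submodule.orthogonalProjectionOnto_apply_of_mem_orthogonal (b₂ k).2]
    exact h ▸ hb₂ k

theorem exists_orthonormalBasis_pencil_of_injective (T S : H →ₗ[ℂ] K)
    (hS : LinearMap.ker S = ⊥)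
    (hsymm : ∀ x, (⟪T.adjoint x, S.adjoint x⟫_ℂ).im = 0) :
    ∃ (ι : Type) (_ : Fintype ι) (b : OrthonormalBasis ι ℂ H), ∀ k, ∃ l : ℝ,
      T (b k) = (l : ℂ) • S (b k) ∧
        ((∀ x, 0 ≤ (⟪T.adjoint x, S.adjoint x⟫_ℂ).re) → 0 ≤ l) := by
  have hsurj : Function.Surjective S.adjoint := by
    rw [← LinearMap.range_eq_top, ← Submodule.orthogonal_eq_bot_iff,
      LinearMap.orthogonal_range, LinearMap.adjoint_adjoint, hS]
  have hTS : T ∘ₗ S.adjoint = S ∘ₗ T.adjoint := by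
    have h : (T ∘ₗ S.adjoint).IsSymmetric := by
      rw [LinearMap.isSymmetric_iff_inner_map_self_real]
      intro x
      rw [LinearMap.comp_apply, ← LinearMap.adjoint_inner_right, Complex.conj_eq_iff_im,
        ← inner_conj_symm, Complex.conj_im, hsymm, neg_zero]
    rw [← (LinearMap.isSymmetric_iff_isSelfAdjoint _).1 h, LinearMap.star_eq_adjoint,
      LinearMap.adjoint_comp, LinearMap.adjoint_adjoint]
  obtain ⟨S', hS'⟩ := S.exists_leftInverse_of_injective hS
  set X := S' ∘ₗ T with hX
  have hXT : ∀ h, S (X h) = T h := by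
    intro h
    obtain ⟨x, rfl⟩ := hsurj h
    have h1 := LinearMap.congr_fun hTS x
    simp only [LinearMap.comp_apply] at h1
    have h2 := LinearMap.congr_fun hS' (T.adjoint x)
    simp only [LinearMap.comp_apply, LinearMap.id_apply] at h2
    rw [hX, LinearMap.comp_apply, h1, h2]
  have hinner : ∀ x, ⟪S.adjoint x, X (S.adjoint x)⟫_ℂ = ⟪T.adjoint x, S.adjoint x⟫_ℂ := by
    intro x
    rw [LinearMap.adjoint_inner_left, hXT, ← LinearMap.adjoint_inner_left]
  have hXsymm : X.IsSymmetric := by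
    rw [LinearMap.isSymmetric_iff_inner_map_self_real]
    intro h
    obtain ⟨x, rfl⟩ := hsurj h
    rw [Complex.conj_eq_iff_im, ← inner_conj_symm, hinner, Complex.conj_im, hsymm, neg_zero]
  refine ⟨Fin (Module.finrank ℂ H), inferInstance, hXsymm.eigenvectorBasis rfl, fun k => ?_⟩
  have hk := hXsymm.apply_eigenvectorBasis rfl k
  refine ⟨hXsymm.eigenvalues rfl k, ?_, fun hpos => ?_⟩
  · rw [← hXT, hk, map_smul]; rfl
  · obtain ⟨x, hx⟩ := hsurj (hXsymm.eigenvectorBasis rfl k)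
    have h1 := hpos x
    rw [← hinner, hx, hk, inner_smul_right, inner_self_eq_norm_sq_to_K,
      (hXsymm.eigenvectorBasis rfl).norm_eq_one] at h1
    simpa using h1

theorem exists_orthonormalBasis_pencil (T S : H →ₗ[ℂ] K)
    (hsymm : ∀ x, (⟪T.adjoint x, S.adjoint x⟫_ℂ).im = 0) :
    ∃ (ι : Type) (_ : Fintype ι) (e : OrthonormalBasis ι ℂ H), ∀ k, ∃ a b : ℝ,
      ¬(a = 0 ∧ b = 0) ∧ (b : ℂ) • T (e k) = (a : ℂ) • S (e k) ∧
        ((∀ x, 0 ≤ (⟪T.adjoint x, S.adjoint x⟫_ℂ).re) → 0 ≤ a ∧ 0 ≤ b) := by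
  refine exists_orthonormalBasis_of_orthogonal (LinearMap.ker S) (fun v => ∃ a b : ℝ,
      ¬(a = 0 ∧ b = 0) ∧ (b : ℂ) • T v = (a : ℂ) • S v ∧
        ((∀ x, 0 ≤ (⟪T.adjoint x, S.adjoint x⟫_ℂ).re) → 0 ≤ a ∧ 0 ≤ b)) ?_ ?_
  · refine ⟨_, inferInstance, stdOrthonormalBasis ℂ _, fun k => ⟨1, 0, by simp, ?_, by simp⟩⟩
    have := (stdOrthonormalBasis ℂ (LinearMap.ker S) k).2
    rw [LinearMap.mem_ker] at this
    simp [this]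
  · set W := LinearMap.ker S with hW
    have hadj : ∀ (R : H →ₗ[ℂ] K) (x : K),
        (((R ∘ₗ Wᗮ.subtype).adjoint x : Wᗮ) : H) = Wᗮ.starProjection (R.adjoint x) := by
      intro R x
      rw [Submodule.starProjection_apply]
      congr 1
      refine ext_inner_right ℂ fun y => ?_
      rw [LinearMap.adjoint_inner_left]
      rw [Submodule.inner_orthogonalProjectionOnto_eq_of_mem_right, LinearMap.adjoint_inner_left]
      rfl
    have hSmem : ∀ x, S.adjoint x ∈ Wᗮ := by
      intro x
      rw [Submodule.mem_orthogonal]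
      intro u hu
      rw [LinearMap.adjoint_inner_right, LinearMap.mem_ker.1 hu, inner_zero_left]
    have hinner : ∀ x, ⟪(T ∘ₗ Wᗮ.subtype).adjoint x, (S ∘ₗ Wᗮ.subtype).adjoint x⟫_ℂ
        = ⟪T.adjoint x, S.adjoint x⟫_ℂ := by
      intro x
      rw [Submodule.coe_inner, hadj, hadj,
        Submodule.inner_starProjection_left_eq_right,
        Submodule.starProjection_eq_self_iff.2 (hSmem x),
        Submodule.starProjection_eq_self_iff.2 (hSmem x)]
    obtain ⟨ι, i, e, he⟩ := exists_orthonormalBasis_pencil_of_injective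
      (T ∘ₗ Wᗮ.subtype) (S ∘ₗ Wᗮ.subtype) (by
        rw [LinearMap.ker_eq_bot']
        intro y hy
        have h1 : (y : H) ∈ W := hy
        have h2 := Submodule.inner_right_of_mem_orthogonal h1 y.2
        exact Subtype.ext (inner_self_eq_zero.1 h2))
      (fun x => by rw [hinner, hsymm])
    refine ⟨ι, i, e, fun k => ?_⟩
    obtain ⟨l, hl, hpos⟩ := he k
    simp only [hinner] at hpos
    exact ⟨l, 1, by simp, by simpa using hl, fun h => ⟨hpos h, zero_le_one⟩⟩

theorem adjoint_smul_add_smul_apply (T S : H →ₗ[ℂ] K) (a b : ℂ) (x : K) :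
    (a • T + b • S).adjoint x = star a • T.adjoint x + star b • S.adjoint x := by
  have h : ∀ (c : ℂ) (R : H →ₗ[ℂ] K), (c • R).adjoint = star c • R.adjoint :=
    fun c R => LinearEquiv.map_smulₛₗ LinearMap.adjoint c R
  rw [map_add, h, h]
  rfl

/-- Simultaneous decomposition of a pair of maps on the real line, with a real quadratic
constraint. -/
theorem exists_orthonormalBasis_pencil_quadratic_of_nonneg (T S : H →ₗ[ℂ] K) {p q r : ℝ}
    (hp : 0 ≤ p) (hr : 0 ≤ r) (hq : 0 ≤ q)
    (hsymm : ∀ x, (⟪T.adjoint x, S.adjoint x⟫_ℂ).im = 0)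
    (hquad : ∀ x, 0 ≤ p * ‖T.adjoint x‖ ^ 2 + 2 * q * (⟪T.adjoint x, S.adjoint x⟫_ℂ).re
      + r * ‖S.adjoint x‖ ^ 2) :
    ∃ (ι : Type) (_ : Fintype ι) (e : OrthonormalBasis ι ℂ H), ∀ k, ∃ a b : ℝ,
      ¬(a = 0 ∧ b = 0) ∧ (b : ℂ) • T (e k) = (a : ℂ) • S (e k) ∧
        0 ≤ p * a ^ 2 + 2 * q * (a * b) + r * b ^ 2 := by
  by_cases hdisc : q ^ 2 ≤ p * r
  · obtain ⟨ι, i, e, he⟩ := exists_orthonormalBasis_pencil T S hsymm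
    refine ⟨ι, i, e, fun k => ?_⟩
    obtain ⟨a, b, hab, heq, -⟩ := he k
    refine ⟨a, b, hab, heq, ?_⟩
    rcases hp.eq_or_lt with rfl | hp
    · have : q = 0 := by nlinarith
      subst this
      nlinarith [mul_nonneg hr (sq_nonneg b)]
    · have h : 0 ≤ p * (p * a ^ 2 + 2 * q * (a * b) + r * b ^ 2) := by
        nlinarith [sq_nonneg (p * a + q * b), mul_nonneg (sub_nonneg.2 hdisc) (sq_nonneg b)]
      exact nonneg_of_mul_nonneg_right h hp
  · push Not at hdisc
    obtain ⟨s, hqs, hss⟩ : ∃ s : ℝ, q < s ∧ s ^ 2 + p * r = 2 * q * s := by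
      refine ⟨q + √(q ^ 2 - p * r), by simpa using hdisc, ?_⟩
      nlinarith [Real.sq_sqrt (sub_nonneg.2 hdisc.le)]
    have hs : 0 < s := hq.trans_lt hqs
    have hdet : 0 < s * s - r * p := by nlinarith
    have key : ∀ x, ⟪((s : ℂ) • T + (r : ℂ) • S).adjoint x,
        ((p : ℂ) • T + (s : ℂ) • S).adjoint x⟫_ℂ =
        ((s * (p * ‖T.adjoint x‖ ^ 2 + 2 * q * (⟪T.adjoint x, S.adjoint x⟫_ℂ).re
          + r * ‖S.adjoint x‖ ^ 2) : ℝ) : ℂ) := by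
      intro x
      have h1 : ⟪T.adjoint x, S.adjoint x⟫_ℂ = ((⟪T.adjoint x, S.adjoint x⟫_ℂ).re : ℂ) :=
        Complex.ext (by simp) (by simp [hsymm])
      have h2 : ⟪S.adjoint x, T.adjoint x⟫_ℂ = ((⟪T.adjoint x, S.adjoint x⟫_ℂ).re : ℂ) := by
        rw [← inner_conj_symm, h1, Complex.conj_ofReal, Complex.ofReal_re]
      have hss' : (s : ℂ) ^ 2 + p * r = 2 * q * s := by exact_mod_cast hss
      simp only [adjoint_smul_add_smul_apply, inner_add_left, inner_add_right, inner_smul_left,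
        inner_smul_right, inner_self_eq_norm_sq_to_K, h2]
      rw [h1]
      simp only [Complex.star_def, Complex.conj_ofReal, Complex.ofReal_re, Complex.ofReal_mul,
        Complex.ofReal_add, Complex.ofReal_pow, Complex.ofReal_ofNat, Complex.coe_algebraMap]
      linear_combination ((⟪T.adjoint x, S.adjoint x⟫_ℂ).re : ℂ) * hss'
    obtain ⟨ι, i, e, he⟩ := exists_orthonormalBasis_pencil ((s : ℂ) • T + (r : ℂ) • S)
      ((p : ℂ) • T + (s : ℂ) • S) (fun x => by rw [key, Complex.ofReal_im])
    refine ⟨ι, i, e, fun k => ?_⟩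
    obtain ⟨a, b, hab, heq, hpos⟩ := he k
    obtain ⟨ha, hb⟩ := hpos fun x => by
      rw [key, Complex.ofReal_re]; exact mul_nonneg hs.le (hquad x)
    refine ⟨s * a - r * b, s * b - p * a, ?_, ?_, ?_⟩
    · rintro ⟨h1, h2⟩
      refine hab ⟨?_, ?_⟩
      · have : (s * s - r * p) * a = 0 := by linear_combination s * h1 + r * h2
        exact (mul_eq_zero.1 this).resolve_left hdet.ne'
      · have : (s * s - r * p) * b = 0 := by linear_combination p * h1 + s * h2
        exact (mul_eq_zero.1 this).resolve_left hdet.ne'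
    · simp only [LinearMap.add_apply, LinearMap.smul_apply] at heq
      push_cast
      linear_combination (norm := module) heq
    · have h : s * (p * (s * a - r * b) ^ 2 + 2 * q * ((s * a - r * b) * (s * b - p * a))
          + r * (s * b - p * a) ^ 2) = (s * s - r * p) ^ 2 * (a * b) := by
        linear_combination -((s * a - r * b) * (s * b - p * a)) * hss
      exact nonneg_of_mul_nonneg_right (h ▸ by positivity) hs

theorem exists_orthonormalBasis_pencil_quadratic (T S : H →ₗ[ℂ] K) {p q r : ℝ}
    (hp : 0 ≤ p) (hr : 0 ≤ r)
    (hsymm : ∀ x, (⟪T.adjoint x, S.adjoint x⟫_ℂ).im = 0)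
    (hquad : ∀ x, 0 ≤ p * ‖T.adjoint x‖ ^ 2 + 2 * q * (⟪T.adjoint x, S.adjoint x⟫_ℂ).re
      + r * ‖S.adjoint x‖ ^ 2) :
    ∃ (ι : Type) (_ : Fintype ι) (e : OrthonormalBasis ι ℂ H), ∀ k, ∃ a b : ℝ,
      ¬(a = 0 ∧ b = 0) ∧ (b : ℂ) • T (e k) = (a : ℂ) • S (e k) ∧
        0 ≤ p * a ^ 2 + 2 * q * (a * b) + r * b ^ 2 := by
  rcases le_total 0 q with hq | hq
  · exact exists_orthonormalBasis_pencil_quadratic_of_nonneg T S hp hr hq hsymm hquad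
  · obtain ⟨ι, i, e, he⟩ := exists_orthonormalBasis_pencil_quadratic_of_nonneg T (-S) hp hr
      (neg_nonneg.2 hq) (fun x => by simp [hsymm]) (fun x => by simpa using hquad x)
    refine ⟨ι, i, e, fun k => ?_⟩
    obtain ⟨a, b, hab, heq, hpos⟩ := he k
    refine ⟨a, -b, by simpa using hab, ?_, by linarith⟩
    simp only [LinearMap.neg_apply, smul_neg] at heq
    simp [heq]

/-- The sesquilinear form `(α₁, β₁) Θ (α₂, β₂)*`. -/
noncomputable def hermPairForm (Θ : Matrix (Fin 2) (Fin 2) ℂ) (α₁ β₁ α₂ β₂ : ℂ) : ℂ :=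
  α₁ * (Θ 0 0 * star α₂ + Θ 0 1 * star β₂) + β₁ * (Θ 1 0 * star α₂ + Θ 1 1 * star β₂)

theorem hermPairVal_eq_hermPairForm (Θ : Matrix (Fin 2) (Fin 2) ℂ) (α β : ℂ) :
    hermPairVal Θ α β = hermPairForm Θ α β α β := by
  simp [hermPairVal, hermPairForm, Matrix.mulVec, dotProduct, Fin.sum_univ_two]

theorem star_hermPairForm {Θ : Matrix (Fin 2) (Fin 2) ℂ} (hΘ : Θ.IsHermitian)
    (α₁ β₁ α₂ β₂ : ℂ) :
    star (hermPairForm Θ α₁ β₁ α₂ β₂) = hermPairForm Θ α₂ β₂ α₁ β₁ := by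
  simp only [hermPairForm, star_add, star_mul', star_star, hΘ.apply]
  ring

theorem hermPairForm_smul_right (Θ : Matrix (Fin 2) (Fin 2) ℂ) (α₁ β₁ α₂ β₂ c : ℂ) :
    hermPairForm Θ α₁ β₁ (c * α₂) (c * β₂) = star c * hermPairForm Θ α₁ β₁ α₂ β₂ := by
  simp only [hermPairForm, star_mul']
  ring

theorem hermPairVal_smul (Θ : Matrix (Fin 2) (Fin 2) ℂ) (α β c : ℂ) :
    hermPairVal Θ (c * α) (c * β) = c * star c * hermPairVal Θ α β := by
  simp only [hermPairVal_eq_hermPairForm, hermPairForm, star_mul']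
  ring

theorem hermPairVal_combination (Θ : Matrix (Fin 2) (Fin 2) ℂ) (α₁ β₁ α₂ β₂ : ℂ) (a b : ℝ) :
    hermPairVal Θ (a * α₁ + b * α₂) (a * β₁ + b * β₂) =
      a ^ 2 * hermPairVal Θ α₁ β₁ + a * b * (hermPairForm Θ α₁ β₁ α₂ β₂ +
        hermPairForm Θ α₂ β₂ α₁ β₁) + b ^ 2 * hermPairVal Θ α₂ β₂ := by
  simp only [hermPairVal_eq_hermPairForm, hermPairForm, star_add, star_mul', Complex.star_def,
    Complex.conj_ofReal]
  ring

/-- The pairing of the `2 × 2` matrix `Θ` with the Gram matrix of `u` and `v`. -/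
noncomputable def gramVal (Θ : Matrix (Fin 2) (Fin 2) ℂ) (u v : H) : ℂ :=
  Θ 0 0 * ⟪u, u⟫_ℂ + Θ 0 1 * ⟪u, v⟫_ℂ + Θ 1 0 * ⟪v, u⟫_ℂ + Θ 1 1 * ⟪v, v⟫_ℂ

omit [FiniteDimensional ℂ H] in
theorem gramVal_combination (Θ : Matrix (Fin 2) (Fin 2) ℂ) (α₁ β₁ α₂ β₂ : ℂ) (u v : H) :
    gramVal Θ (star α₁ • u + star α₂ • v) (star β₁ • u + star β₂ • v) =
      hermPairVal Θ α₁ β₁ * ⟪u, u⟫_ℂ + hermPairForm Θ α₁ β₁ α₂ β₂ * ⟪u, v⟫_ℂ +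
        hermPairForm Θ α₂ β₂ α₁ β₁ * ⟪v, u⟫_ℂ + hermPairVal Θ α₂ β₂ * ⟪v, v⟫_ℂ := by
  simp only [gramVal, hermPairVal_eq_hermPairForm, hermPairForm, inner_add_left, inner_add_right,
    inner_smul_left, inner_smul_right, Complex.star_def, Complex.conj_conj]
  ring

/-- A pair of maps whose Gram data satisfies the constraints of `Θ₁` and `Θ₂` decomposes along
an orthonormal basis into points of the curve segment, when the curve is normalized. -/
theorem exists_orthonormalBasis_curve_of_normalized {Θ₁ Θ₂ : Matrix (Fin 2) (Fin 2) ℂ}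
    (hΘ₁ : Θ₁.IsHermitian) (hΘ₂ : Θ₂.IsHermitian) {α₁ β₁ α₂ β₂ : ℂ}
    (hΔ : α₁ * β₂ - α₂ * β₁ ≠ 0)
    (h₁₁ : hermPairVal Θ₁ α₁ β₁ = 0) (h₁₂ : hermPairVal Θ₁ α₂ β₂ = 0)
    (hI : hermPairForm Θ₁ α₁ β₁ α₂ β₂ = Complex.I)
    (h₂₁ : 0 ≤ (hermPairVal Θ₂ α₁ β₁).re) (h₂₂ : 0 ≤ (hermPairVal Θ₂ α₂ β₂).re)
    (T S : H →ₗ[ℂ] K)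
    (hT₁ : ∀ x, gramVal Θ₁ (T.adjoint x) (S.adjoint x) = 0)
    (hT₂ : ∀ x, 0 ≤ (gramVal Θ₂ (T.adjoint x) (S.adjoint x)).re) :
    ∃ (ι : Type) (_ : Fintype ι) (e : OrthonormalBasis ι ℂ H), ∀ k, ∃ α β : ℂ,
      ¬(α = 0 ∧ β = 0) ∧ hermPairVal Θ₁ α β = 0 ∧ 0 ≤ (hermPairVal Θ₂ α β).re ∧
        α • S (e k) = β • T (e k) := by
  set Δ := α₁ * β₂ - α₂ * β₁ with hΔdef
  set T' := (β₂ / Δ) • T + (-α₂ / Δ) • S with hT'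
  set S' := (-β₁ / Δ) • T + (α₁ / Δ) • S with hS'
  have hT : T = α₁ • T' + α₂ • S' := by
    have h1 : α₁ * (β₂ / Δ) + α₂ * (-β₁ / Δ) = 1 := by field_simp; rw [hΔdef]; ring
    have h2 : α₁ * (-α₂ / Δ) + α₂ * (α₁ / Δ) = 0 := by field_simp; ring
    linear_combination (norm := (rw [hT', hS']; module)) -h1 • T - h2 • S
  have hS : S = β₁ • T' + β₂ • S' := by
    have h1 : β₁ * (β₂ / Δ) + β₂ * (-β₁ / Δ) = 0 := by field_simp; ring
    have h2 : β₁ * (-α₂ / Δ) + β₂ * (α₁ / Δ) = 1 := by field_simp; rw [hΔdef]; ring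
    linear_combination (norm := (rw [hT', hS']; module)) -h1 • T - h2 • S
  have hgram : ∀ (Θ : Matrix (Fin 2) (Fin 2) ℂ) (x : K),
      gramVal Θ (T.adjoint x) (S.adjoint x) =
      hermPairVal Θ α₁ β₁ * ⟪T'.adjoint x, T'.adjoint x⟫_ℂ +
        hermPairForm Θ α₁ β₁ α₂ β₂ * ⟪T'.adjoint x, S'.adjoint x⟫_ℂ +
        hermPairForm Θ α₂ β₂ α₁ β₁ * ⟪S'.adjoint x, T'.adjoint x⟫_ℂ +
        hermPairVal Θ α₂ β₂ * ⟪S'.adjoint x, S'.adjoint x⟫_ℂ := by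
    intro Θ x
    rw [← gramVal_combination, ← adjoint_smul_add_smul_apply, ← adjoint_smul_add_smul_apply,
      ← hT, ← hS]
  have hI' : hermPairForm Θ₁ α₂ β₂ α₁ β₁ = -Complex.I := by
    rw [← star_hermPairForm hΘ₁, hI]; simp
  have hsymm : ∀ x, (⟪T'.adjoint x, S'.adjoint x⟫_ℂ).im = 0 := by
    intro x
    have h := hT₁ x
    rw [hgram, h₁₁, h₁₂, hI, hI', ← inner_conj_symm (S'.adjoint x) (T'.adjoint x)] at h
    have := congrArg Complex.re h
    simp [-inner_conj_symm] at this
    linarith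
  have hform : hermPairForm Θ₂ α₂ β₂ α₁ β₁ = star (hermPairForm Θ₂ α₁ β₁ α₂ β₂) :=
    (star_hermPairForm hΘ₂ _ _ _ _).symm
  obtain ⟨ι, i, e, he⟩ := exists_orthonormalBasis_pencil_quadratic T' S' h₂₁ h₂₂
    (q := (hermPairForm Θ₂ α₁ β₁ α₂ β₂).re) hsymm (by
      intro x
      have h := hT₂ x
      rw [hgram, hform, ← inner_conj_symm (S'.adjoint x) (T'.adjoint x)] at h
      simp only [inner_self_eq_norm_sq_to_K, Complex.coe_algebraMap, ← Complex.ofReal_pow,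
        Complex.add_re, Complex.ofReal_re, Complex.ofReal_im, Complex.mul_re,
        Complex.star_def, Complex.conj_re, Complex.conj_im, hsymm] at h
      linarith)
  refine ⟨ι, i, e, fun k => ?_⟩
  obtain ⟨a, b, hab, heq, hpos⟩ := he k
  refine ⟨a * α₁ + b * α₂, a * β₁ + b * β₂, ?_, ?_, ?_, ?_⟩
  · rintro ⟨h1, h2⟩
    refine hab ⟨?_, ?_⟩
    · have : (a : ℂ) * Δ = 0 := by rw [hΔdef]; linear_combination β₂ * h1 - α₂ * h2
      exact_mod_cast (mul_eq_zero.1 this).resolve_right hΔ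
    · have : (b : ℂ) * Δ = 0 := by rw [hΔdef]; linear_combination α₁ * h2 - β₁ * h1
      exact_mod_cast (mul_eq_zero.1 this).resolve_right hΔ
  · rw [hermPairVal_combination, h₁₁, h₁₂, hI, hI']
    ring
  · rw [hermPairVal_combination, hform]
    simp only [← Complex.ofReal_pow, ← Complex.ofReal_mul, Complex.add_re, Complex.re_ofReal_mul,
      Complex.star_def, Complex.conj_re]
    linarith
  · rw [hT, hS]
    simp only [LinearMap.add_apply, LinearMap.smul_apply]
    linear_combination (norm := module) -Δ • heq

theorem exists_orthonormalBasis_curve {Θ₁ Θ₂ : Matrix (Fin 2) (Fin 2) ℂ}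
    (hΘ₁ : Θ₁.IsHermitian) (hΘ₂ : Θ₂.IsHermitian) (hdet : Θ₁.det.re < 0)
    (htwo : ∃ α₁ β₁ α₂ β₂ : ℂ, ¬(α₁ = 0 ∧ β₁ = 0) ∧ ¬(α₂ = 0 ∧ β₂ = 0) ∧
      (∀ c : ℂ, ¬(α₂ = c * α₁ ∧ β₂ = c * β₁)) ∧
      hermPairVal Θ₁ α₁ β₁ = 0 ∧ 0 ≤ (hermPairVal Θ₂ α₁ β₁).re ∧
      hermPairVal Θ₁ α₂ β₂ = 0 ∧ 0 ≤ (hermPairVal Θ₂ α₂ β₂).re)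
    (T S : H →ₗ[ℂ] K)
    (hT₁ : ∀ x, gramVal Θ₁ (T.adjoint x) (S.adjoint x) = 0)
    (hT₂ : ∀ x, 0 ≤ (gramVal Θ₂ (T.adjoint x) (S.adjoint x)).re) :
    ∃ (ι : Type) (_ : Fintype ι) (e : OrthonormalBasis ι ℂ H), ∀ k, ∃ α β : ℂ,
      ¬(α = 0 ∧ β = 0) ∧ hermPairVal Θ₁ α β = 0 ∧ 0 ≤ (hermPairVal Θ₂ α β).re ∧
        α • S (e k) = β • T (e k) := by
  obtain ⟨α₁, β₁, α₂, β₂, h₁, -, hind, h₁₁, h₂₁, h₁₂, h₂₂⟩ := htwo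
  have hΔ : α₁ * β₂ - α₂ * β₁ ≠ 0 := by
    intro h
    by_cases hα : α₁ = 0
    · have hβ : β₁ ≠ 0 := fun hβ => h₁ ⟨hα, hβ⟩
      subst hα
      have : α₂ = 0 := by simpa [hβ] using h
      exact hind (β₂ / β₁) ⟨by simp [this], by field_simp⟩
    · exact hind (α₂ / α₁) ⟨by field_simp, by field_simp; linear_combination h⟩
  set c := hermPairForm Θ₁ α₁ β₁ α₂ β₂ with hc
  have hc0 : c ≠ 0 := by
    intro h0
    have hid : hermPairVal Θ₁ α₁ β₁ * hermPairVal Θ₁ α₂ β₂ - c * hermPairForm Θ₁ α₂ β₂ α₁ β₁ =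
        (α₁ * β₂ - α₂ * β₁) * star (α₁ * β₂ - α₂ * β₁) * Θ₁.det := by
      simp only [hc, hermPairVal_eq_hermPairForm, hermPairForm, Matrix.det_fin_two, star_sub,
        star_mul']
      ring
    rw [h₁₁, h0, zero_mul, zero_mul, sub_zero] at hid
    have hdet0 : Θ₁.det = 0 :=
      (mul_eq_zero.1 hid.symm).resolve_left (mul_ne_zero hΔ (star_ne_zero.2 hΔ))
    simp [hdet0] at hdet
  set μ := star (Complex.I / c) with hμ
  have hμ0 : μ ≠ 0 := by simp [hμ, hc0]
  refine exists_orthonormalBasis_curve_of_normalized hΘ₁ hΘ₂ (α₁ := α₁) (β₁ := β₁) (α₂ := μ * α₂)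
    (β₂ := μ * β₂) ?_ h₁₁ ?_ ?_ h₂₁ ?_ T S hT₁ hT₂
  · intro h
    exact mul_ne_zero hμ0 hΔ (by linear_combination h)
  · rw [hermPairVal_smul, h₁₂, mul_zero]
  · rw [hermPairForm_smul_right, hμ, star_star, ← hc, div_mul_cancel₀ _ hc0]
  · rw [hermPairVal_smul, Complex.star_def, Complex.mul_conj, Complex.re_ofReal_mul]
    exact mul_nonneg (Complex.normSq_nonneg _) h₂₂

end Pencil

section Separation

/-- Positivity of the real part of the quadratic form of a matrix is an open condition. -/
lemma isOpen_setOf_forall_re_quadratic_pos {z : Type*} [Fintype z] :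
    IsOpen {P : Matrix z z ℂ | ∀ x : z → ℂ, x ≠ 0 → 0 < (star x ⬝ᵥ P *ᵥ x).re} := by
  rw [isOpen_iff_eventually]
  intro P hP
  have hsphere : ∀ᶠ Q in nhds P, ∀ x ∈ Metric.sphere (0 : z → ℂ) 1,
      0 < (star x ⬝ᵥ Q *ᵥ x).re := by
    refine (isCompact_sphere (0 : z → ℂ) 1).eventually_forall_of_forall_eventually fun x hx => ?_
    have hx0 : x ≠ 0 := ne_zero_of_mem_unit_sphere (⟨x, hx⟩ : Metric.sphere (0 : z → ℂ) 1)
    have hcont : Continuous fun q : Matrix z z ℂ × (z → ℂ) =>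
        (star q.2 ⬝ᵥ q.1 *ᵥ q.2).re :=
      Complex.continuous_re.comp
        (continuous_snd.star.dotProduct (continuous_fst.matrix_mulVec continuous_snd))
    exact hcont.continuousAt.eventually (lt_mem_nhds (hP x hx0))
  filter_upwards [hsphere] with Q hQ x hx
  have hnorm : 0 < ‖x‖ := norm_pos_iff.2 hx
  have hy := hQ (((‖x‖⁻¹ : ℝ) : ℂ) • x) (by
    rw [mem_sphere_zero_iff_norm, norm_smul, Complex.norm_real, norm_inv, norm_norm,
      inv_mul_cancel₀ hnorm.ne'])
  rw [mulVec_smul, star_smul, smul_dotProduct, dotProduct_smul, smul_eq_mul, smul_eq_mul,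
    Complex.star_def, Complex.conj_ofReal, Complex.re_ofReal_mul, Complex.re_ofReal_mul] at hy
  have hinv : 0 < ‖x‖⁻¹ := inv_pos.2 hnorm
  exact pos_of_mul_pos_right (pos_of_mul_pos_right hy hinv.le) hinv.le

lemma nonneg_of_forall_add_mul_nonneg {a c : ℝ} (h : ∀ t > 0, 0 ≤ a + t * c) : 0 ≤ a := by
  have ht : Filter.Tendsto (fun t : ℝ => a + t * c) (nhdsWithin 0 (Set.Ioi 0)) (nhds a) := by
    have hc : Continuous fun t : ℝ => a + t * c := by fun_prop
    simpa using (hc.tendsto 0).mono_left nhdsWithin_le_nhds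
  exact ge_of_tendsto ht (by filter_upwards [self_mem_nhdsWithin] with t ht using h t ht)

/-- A linear functional on complex matrices is a trace pairing. -/
lemma exists_forall_eq_trace_mul {z : Type*} [Fintype z] [DecidableEq z]
    (f : Matrix z z ℂ →ₗ[ℂ] ℂ) : ∃ Z : Matrix z z ℂ, ∀ A, f A = (Z * A).trace := by
  refine ⟨of fun j i => f (single i j 1), fun A => ?_⟩
  conv_lhs => rw [matrix_eq_sum_single A]
  simp only [map_sum, trace, diag, mul_apply, of_apply]
  rw [Finset.sum_comm]
  refine Finset.sum_congr rfl fun j _ => Finset.sum_congr rfl fun i _ => ?_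
  rw [← mul_one (A i j), ← smul_eq_mul, ← smul_single, map_smul]
  simp [mul_comm]

open scoped MatrixOrder in
lemma Matrix.PosSemidef.exists_eq_mul_conjTranspose {z : Type*} [Fintype z] [DecidableEq z]
    {Z : Matrix z z ℂ} (hZ : Z.PosSemidef) : ∃ L : Matrix z z ℂ, Z = L * Lᴴ :=
  (CStarAlgebra.nonneg_iff_eq_mul_star_self).1 hZ.nonneg

lemma re_trace_mul_eq_of_isHermitian {z : Type*} [Fintype z] (Z : Matrix z z ℂ)
    {A : Matrix z z ℂ} (hA : A.IsHermitian) : (Zᴴ * A).trace.re = (Z * A).trace.re := by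
  have h : (Zᴴ * A).trace = star (Z * A).trace := by
    rw [← trace_conjTranspose, conjTranspose_mul, hA.eq, trace_mul_comm]
  rw [h, Complex.star_def, Complex.conj_re]

/-- If the linear matrix inequality `G ≻ A H₁ + B H₂`, `H₂ ≻ 0`, has no Hermitian solution, then
a nonzero positive semidefinite matrix `L * Lᴴ` witnesses the infeasibility. -/
theorem exists_mul_conjTranspose_of_not_exists_posDef {k z : Type*} [Fintype k] [DecidableEq k]
    [Fintype z] [DecidableEq z] (A B : Matrix k k ℂ →ₗ[ℂ] Matrix z z ℂ)
    (hA : ∀ H : Matrix k k ℂ, H.IsHermitian → (A H).IsHermitian)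
    (hB : ∀ H : Matrix k k ℂ, H.IsHermitian → (B H).IsHermitian)
    {G : Matrix z z ℂ} (hG : G.IsHermitian)
    (hno : ¬ ∃ H₁ H₂ : Matrix k k ℂ, H₁.IsHermitian ∧ H₂.PosDef ∧
      (G - (A H₁ + B H₂)).PosDef) :
    ∃ L : Matrix z z ℂ, L ≠ 0 ∧
      (∀ H : Matrix k k ℂ, H.IsHermitian → (L * Lᴴ * A H).trace.re = 0) ∧
      (∀ H : Matrix k k ℂ, H.PosSemidef → 0 ≤ (L * Lᴴ * B H).trace.re) ∧
      (L * Lᴴ * G).trace.re ≤ 0 := by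
  let U : Set (Matrix z z ℂ) := {P | ∀ x : z → ℂ, x ≠ 0 → 0 < (star x ⬝ᵥ P *ᵥ x).re}
  have hU : IsOpen U := isOpen_setOf_forall_re_quadratic_pos
  have hUadd : ∀ P ∈ U, ∀ Q ∈ U, P + Q ∈ U := fun P hP Q hQ x hx => by
    rw [add_mulVec, dotProduct_add, Complex.add_re]
    exact add_pos (hP x hx) (hQ x hx)
  have hUsmul : ∀ P ∈ U, ∀ t : ℝ, 0 < t → (t : ℂ) • P ∈ U := fun P hP t ht x hx => by
    rw [smul_mulVec, dotProduct_smul, smul_eq_mul, Complex.re_ofReal_mul]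
    exact mul_pos ht (hP x hx)
  have hUpos : ∀ P : Matrix z z ℂ, P.PosDef → P ∈ U := fun P hP x hx =>
    (Complex.pos_iff.1 (hP.dotProduct_mulVec_pos hx)).1
  let S : Set (Matrix z z ℂ) := {X | ∃ H₁ H₂ : Matrix k k ℂ, H₁.IsHermitian ∧ H₂.PosDef ∧
    X - (A H₁ + B H₂) ∈ U}
  have hSopen : IsOpen S := by
    have : S = ⋃ (H₁ : Matrix k k ℂ) (H₂ : Matrix k k ℂ) (_ : H₁.IsHermitian ∧ H₂.PosDef),
        (fun X => X - (A H₁ + B H₂)) ⁻¹' U := by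
      ext X
      simp [S]
    rw [this]
    exact isOpen_iUnion fun H₁ => isOpen_iUnion fun H₂ => isOpen_iUnion fun _ =>
      hU.preimage (continuous_id.sub continuous_const)
  have hSadd : ∀ X ∈ S, ∀ Y ∈ S, X + Y ∈ S := by
    rintro X ⟨H₁, H₂, h₁, h₂, hX⟩ Y ⟨K₁, K₂, k₁, k₂, hY⟩
    refine ⟨H₁ + K₁, H₂ + K₂, h₁.add k₁, h₂.add k₂, ?_⟩
    convert hUadd _ hX _ hY using 1
    rw [map_add, map_add]
    abel
  have hSsmul : ∀ X ∈ S, ∀ t : ℝ, 0 < t → (t : ℂ) • X ∈ S := by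
    rintro X ⟨H₁, H₂, h₁, h₂, hX⟩ t ht
    refine ⟨(t : ℂ) • H₁, (t : ℂ) • H₂, ?_, h₂.smul (by exact_mod_cast ht), ?_⟩
    · rw [IsHermitian, conjTranspose_smul, h₁.eq, Complex.star_def, Complex.conj_ofReal]
    · convert hUsmul _ hX t ht using 1
      rw [map_smul, map_smul, ← smul_add, ← smul_sub]
  have hSconv : Convex ℝ S := by
    rw [convex_iff_forall_pos]
    intro X hX Y hY a b ha hb _
    have hcast : ∀ (t : ℝ) (W : Matrix z z ℂ), t • W = (t : ℂ) • W := fun t W => by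
      ext i j; simp
    rw [hcast, hcast]
    exact hSadd _ (hSsmul X hX a ha) _ (hSsmul Y hY b hb)
  have hGS : G ∉ S := by
    rintro ⟨H₁, H₂, h₁, h₂, hX⟩
    refine hno ⟨H₁, H₂, h₁, h₂, ?_⟩
    have hherm : (G - (A H₁ + B H₂)).IsHermitian := hG.sub ((hA _ h₁).add (hB _ h₂.1))
    refine PosDef.of_dotProduct_mulVec_pos hherm fun x hx => Complex.pos_iff.2 ⟨hX x hx, ?_⟩
    exact (hherm.im_star_dotProduct_mulVec_self x).symm
  obtain ⟨f, hf⟩ : ∃ f : Matrix z z ℂ →ₗ[ℂ] ℂ, ∀ X ∈ S, (f G).re < (f X).re := by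
    let _ : NormedAddCommGroup (Matrix z z ℂ) := Matrix.normedAddCommGroup
    let _ : NormedSpace ℂ (Matrix z z ℂ) := Matrix.normedSpace
    let _ : NormedSpace ℝ (Matrix z z ℂ) := Matrix.normedSpace
    obtain ⟨f, hf⟩ := RCLike.geometric_hahn_banach_point_open (𝕜 := ℂ) hSconv hSopen hGS
    exact ⟨f, hf⟩
  have hX₀ : B 1 + 1 ∈ S := ⟨0, 1, isHermitian_zero, PosDef.one, by
    simpa using hUpos 1 PosDef.one⟩
  have hre : ∀ (t : ℝ) (X : Matrix z z ℂ), (f ((t : ℂ) • X)).re = t * (f X).re := fun t X => by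
    rw [map_smul, smul_eq_mul, Complex.re_ofReal_mul]
  have hSnonneg : ∀ X ∈ S, 0 ≤ (f X).re := by
    intro X hX
    by_contra! hneg
    have hlt := hf _ (hSsmul X hX ((|(f G).re| + 1) / -(f X).re)
      (div_pos (by positivity) (neg_pos.2 hneg)))
    rw [hre, div_mul_eq_mul_div, div_neg, mul_div_cancel_right₀ _ hneg.ne] at hlt
    linarith [neg_abs_le (f G).re]
  have hGnonpos : (f G).re ≤ 0 := by
    have := nonneg_of_forall_add_mul_nonneg (a := -(f G).re) (c := (f (B 1 + 1)).re)
      fun t ht => by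
        have := hf _ (hSsmul _ hX₀ t ht)
        rw [hre] at this
        linarith
    linarith
  have hcone : ∀ (H₁ H₂ : Matrix k k ℂ) (P : Matrix z z ℂ), H₁.IsHermitian → H₂.PosSemidef →
      P.PosSemidef → 0 ≤ (f (A H₁ + B H₂ + P)).re := by
    intro H₁ H₂ P h₁ h₂ hP
    refine nonneg_of_forall_add_mul_nonneg (c := (f (B 1 + 1)).re) fun t ht => ?_
    rw [← hre, ← Complex.add_re, ← map_add]
    have htc : (0 : ℂ) < t := by exact_mod_cast ht
    refine hSnonneg _ ⟨H₁, H₂ + (t : ℂ) • 1, h₁, (PosDef.one.smul htc).posSemidef_add h₂, ?_⟩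
    convert hUpos _ ((PosDef.one.smul htc).posSemidef_add hP) using 1
    rw [map_add, map_smul, smul_add]
    abel
  obtain ⟨Z, hZ⟩ := exists_forall_eq_trace_mul f
  have hherm : ∀ X : Matrix z z ℂ, X.IsHermitian →
      ((((2 : ℂ)⁻¹ • (Z + Zᴴ)) * X).trace).re = (f X).re := fun X hX => by
    have h2 : ((2 : ℂ)⁻¹) = ((2⁻¹ : ℝ) : ℂ) := by norm_num
    rw [smul_mul, trace_smul, smul_eq_mul, h2, Complex.re_ofReal_mul, add_mul, trace_add,
      Complex.add_re, re_trace_mul_eq_of_isHermitian Z hX, hZ]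
    ring
  have hZherm : ((2 : ℂ)⁻¹ • (Z + Zᴴ)).IsHermitian := by
    rw [IsHermitian, conjTranspose_smul, conjTranspose_add, conjTranspose_conjTranspose,
      add_comm]
    simp
  have hZpos : ((2 : ℂ)⁻¹ • (Z + Zᴴ)).PosSemidef := by
    refine PosSemidef.of_dotProduct_mulVec_nonneg hZherm fun x => Complex.nonneg_iff.2
      ⟨?_, (hZherm.im_star_dotProduct_mulVec_self x).symm⟩
    have hx := posSemidef_vecMulVec_self_star x
    have h := hcone 0 0 _ isHermitian_zero PosSemidef.zero hx
    rw [map_zero, map_zero, zero_add, zero_add, ← hherm _ hx.1, mul_vecMulVec,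
      trace_vecMulVec, dotProduct_comm] at h
    exact h
  obtain ⟨L, hL⟩ := hZpos.exists_eq_mul_conjTranspose
  rw [hL] at hherm
  refine ⟨L, ?_, fun H hH => ?_, fun H hH => ?_, ?_⟩
  · rintro rfl
    have hX₀herm : (B 1 + 1).IsHermitian := (hB 1 isHermitian_one).add isHermitian_one
    have hlt := hf _ hX₀
    rw [← hherm _ hG, ← hherm _ hX₀herm] at hlt
    simp at hlt
  · rw [hherm _ (hA H hH)]
    have h₁ := hcone H 0 0 hH PosSemidef.zero PosSemidef.zero
    have h₂ := hcone (-H) 0 0 hH.neg PosSemidef.zero PosSemidef.zero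
    simp only [map_zero, add_zero, map_neg, Complex.neg_re] at h₁ h₂
    linarith
  · rw [hherm _ (hB H hH.1)]
    simpa using hcone 0 H 0 isHermitian_zero hH PosSemidef.zero
  · rwa [hherm _ hG]

end Separation

section Lyapunov

variable {k z : Type} [Fintype k] (M N : Matrix k z ℂ)
  (Θ : Matrix (Fin 2) (Fin 2) ℂ)

/-- The adjoint generalized Lyapunov operator as a linear map. -/
noncomputable def lyapAdjLinearMap : Matrix k k ℂ →ₗ[ℂ] Matrix z z ℂ where
  toFun := lyapAdj M N Θ
  map_add' H K := by
    simp only [lyapAdj, Matrix.mul_add, Matrix.add_mul, smul_add]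
    abel
  map_smul' c H := by
    simp only [lyapAdj, Matrix.mul_smul, Matrix.smul_mul, smul_add, smul_comm c, RingHom.id_apply]

variable {Θ}

lemma isHermitian_lyapAdj (hΘ : Θ.IsHermitian) {H : Matrix k k ℂ} (hH : H.IsHermitian) :
    (lyapAdj M N Θ H).IsHermitian := by
  have hMM : (Mᴴ * H * M)ᴴ = Mᴴ * H * M := isHermitian_conjTranspose_mul_mul M hH
  have hNN : (Nᴴ * H * N)ᴴ = Nᴴ * H * N := isHermitian_conjTranspose_mul_mul N hH
  have hMN : (Mᴴ * H * N)ᴴ = Nᴴ * H * M := by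
    simp [conjTranspose_mul, hH.eq, Matrix.mul_assoc]
  have hNM : (Nᴴ * H * M)ᴴ = Mᴴ * H * N := by
    simp [conjTranspose_mul, hH.eq, Matrix.mul_assoc]
  simp only [IsHermitian, lyapAdj, conjTranspose_add, conjTranspose_smul, hMM, hNN, hMN, hNM,
    hΘ.apply]
  abel

variable (Θ) [Fintype z]

lemma star_dotProduct_lyapAdj_mulVec (H : Matrix k k ℂ) {u : z → ℂ} {w : k → ℂ} {α β : ℂ}
    (hM : M *ᵥ u = α • w) (hN : N *ᵥ u = β • w) :
    star u ⬝ᵥ lyapAdj M N Θ H *ᵥ u = hermPairVal Θ α β * (star w ⬝ᵥ H *ᵥ w) := by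
  have hterm : ∀ P Q : Matrix k z ℂ, ∀ a b : ℂ, P *ᵥ u = a • w → Q *ᵥ u = b • w →
      star u ⬝ᵥ (Pᴴ * H * Q) *ᵥ u = star a * b * (star w ⬝ᵥ H *ᵥ w) := by
    intro P Q a b hP hQ
    rw [← mulVec_mulVec, ← mulVec_mulVec, dotProduct_mulVec, ← star_mulVec, hP, hQ, mulVec_smul,
      dotProduct_smul, star_smul, smul_dotProduct, smul_eq_mul, smul_eq_mul]
    ring
  simp only [lyapAdj, add_mulVec, smul_mulVec, dotProduct_add, dotProduct_smul, smul_eq_mul,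
    hterm _ _ _ _ hM hM, hterm _ _ _ _ hM hN, hterm _ _ _ _ hN hM, hterm _ _ _ _ hN hN,
    hermPairVal_eq_hermPairForm, hermPairForm]
  ring

lemma trace_mul_lyapAdj_vecMulVec [DecidableEq k] [DecidableEq z] (L : Matrix z z ℂ) (x : k → ℂ) :
    (L * Lᴴ * lyapAdj M N Θ (vecMulVec x (star x))).trace =
      gramVal Θ ((toEuclideanLin (M * L)).adjoint (WithLp.toLp 2 x))
        ((toEuclideanLin (N * L)).adjoint (WithLp.toLp 2 x)) := by
  have hterm : ∀ P Q : Matrix k z ℂ, (L * Lᴴ * (Pᴴ * vecMulVec x (star x) * Q)).trace =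
      ⟪(toEuclideanLin (Q * L)).adjoint (WithLp.toLp 2 x),
        (toEuclideanLin (P * L)).adjoint (WithLp.toLp 2 x)⟫_ℂ := by
    intro P Q
    rw [← toEuclideanLin_conjTranspose_eq_adjoint, ← toEuclideanLin_conjTranspose_eq_adjoint,
      EuclideanSpace.inner_eq_star_dotProduct, mul_vecMulVec, vecMulVec_mul, mul_vecMulVec,
      trace_vecMulVec, conjTranspose_mul, conjTranspose_mul]
    simp only [toLpLin_apply, ← mulVec_mulVec, star_mulVec, conjTranspose_conjTranspose]
    rw [dotProduct_comm, dotProduct_comm _ (_ ᵥ* _), dotProduct_mulVec]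
  simp only [lyapAdj, Matrix.mul_add, Matrix.mul_smul, trace_add, trace_smul, smul_eq_mul, hterm,
    gramVal]
  ring

end Lyapunov

lemma trace_mul_conjTranspose_mul_eq_sum {z ι : Type*} [Fintype z] [DecidableEq z] [Fintype ι]
    (L G : Matrix z z ℂ) (e : OrthonormalBasis ι ℂ (EuclideanSpace ℂ z)) :
    (L * Lᴴ * G).trace = ∑ k, star (L *ᵥ (e k).ofLp) ⬝ᵥ G *ᵥ (L *ᵥ (e k).ofLp) := by
  have htrace : (toEuclideanLin (Lᴴ * G * L)).trace ℂ _ = (Lᴴ * G * L).trace := by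
    rw [show toEuclideanLin (𝕜 := ℂ) (m := z) (n := z) = _ from toLpLin_eq_toLin 2 2,
      trace_toLin_eq]
  rw [Matrix.mul_assoc, trace_mul_comm, ← htrace, LinearMap.trace_eq_sum_inner _ e]
  refine Finset.sum_congr rfl fun k _ => ?_
  rw [EuclideanSpace.inner_eq_star_dotProduct, dotProduct_comm]
  simp only [toLpLin_apply, ← mulVec_mulVec]
  rw [dotProduct_mulVec, ← star_mulVec]

/-- **Lossless S-procedure** on a curve segment: if the quadratic form of `G` is positive at every
nonzero vector annihilated by some `αN - βM` with `(α, β)` in `Γ_{Θ₁} ∩ Ω_{Θ₂}`, then the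
corresponding linear matrix inequality is solvable. -/
theorem exists_posDef_sub_lyapAdj {k z : Type} [Fintype k] [DecidableEq k] [Fintype z]
    [DecidableEq z] (M N : Matrix k z ℂ) {Θ₁ Θ₂ : Matrix (Fin 2) (Fin 2) ℂ}
    (hΘ₁ : Θ₁.IsHermitian) (hΘ₂ : Θ₂.IsHermitian) (hdet : Θ₁.det.re < 0)
    (htwo : ∃ α₁ β₁ α₂ β₂ : ℂ, ¬(α₁ = 0 ∧ β₁ = 0) ∧ ¬(α₂ = 0 ∧ β₂ = 0) ∧
      (∀ c : ℂ, ¬(α₂ = c * α₁ ∧ β₂ = c * β₁)) ∧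
      hermPairVal Θ₁ α₁ β₁ = 0 ∧ 0 ≤ (hermPairVal Θ₂ α₁ β₁).re ∧
      hermPairVal Θ₁ α₂ β₂ = 0 ∧ 0 ≤ (hermPairVal Θ₂ α₂ β₂).re)
    {G : Matrix z z ℂ} (hG : G.IsHermitian)
    (hpos : ∀ α β : ℂ, ¬(α = 0 ∧ β = 0) → hermPairVal Θ₁ α β = 0 →
      0 ≤ (hermPairVal Θ₂ α β).re → ∀ u : z → ℂ, u ≠ 0 → (α • N - β • M) *ᵥ u = 0 →
        0 < (star u ⬝ᵥ G *ᵥ u).re) :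
    ∃ H₁ H₂ : Matrix k k ℂ, H₁.IsHermitian ∧ H₂.PosDef ∧
      (G - (lyapAdj M N Θ₁ H₁ + lyapAdj M N Θ₂ H₂)).PosDef := by
  by_contra hno
  obtain ⟨L, hL, hL₁, hL₂, hLG⟩ := exists_mul_conjTranspose_of_not_exists_posDef
    (lyapAdjLinearMap M N Θ₁) (lyapAdjLinearMap M N Θ₂)
    (fun _ => isHermitian_lyapAdj M N hΘ₁) (fun _ => isHermitian_lyapAdj M N hΘ₂) hG hno
  obtain ⟨ι, _, e, he⟩ := exists_orthonormalBasis_curve hΘ₁ hΘ₂ hdet htwo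
    (toEuclideanLin (M * L)) (toEuclideanLin (N * L))
    (fun x => by
      have hx := posSemidef_vecMulVec_self_star x.ofLp
      have hre := hL₁ _ hx.1
      have him : (L * Lᴴ * lyapAdj M N Θ₁ (vecMulVec x.ofLp (star x.ofLp))).trace.im = 0 := by
        have hherm := isHermitian_conjTranspose_mul_mul L (isHermitian_lyapAdj M N hΘ₁ hx.1)
        rw [Matrix.mul_assoc, trace_mul_comm, ← Complex.conj_eq_iff_im, ← Complex.star_def,
          ← trace_conjTranspose, hherm.eq]
      rw [← WithLp.toLp_ofLp 2 x, ← trace_mul_lyapAdj_vecMulVec]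
      exact Complex.ext hre him)
    (fun x => by
      rw [← WithLp.toLp_ofLp 2 x, ← trace_mul_lyapAdj_vecMulVec]
      exact hL₂ _ (posSemidef_vecMulVec_self_star x.ofLp))
  have hterm : ∀ k, L *ᵥ (e k).ofLp ≠ 0 →
      0 < (star (L *ᵥ (e k).ofLp) ⬝ᵥ G *ᵥ (L *ᵥ (e k).ofLp)).re := by
    intro k hk
    obtain ⟨α, β, hαβ, h₁, h₂, h⟩ := he k
    refine hpos α β hαβ h₁ h₂ _ hk ?_
    have h' := congrArg WithLp.ofLp h
    simp only [toLpLin_apply, WithLp.ofLp_smul, ← mulVec_mulVec] at h'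
    rw [sub_mulVec, smul_mulVec, smul_mulVec, h', sub_self]
  have hzero : ∀ k, L *ᵥ (e k).ofLp = 0 := by
    by_contra! hex
    obtain ⟨k₀, hk₀⟩ := hex
    refine hLG.not_gt ?_
    rw [trace_mul_conjTranspose_mul_eq_sum L G e, Complex.re_sum]
    refine Finset.sum_pos' (fun k _ => ?_) ⟨k₀, Finset.mem_univ _, hterm k₀ hk₀⟩
    by_cases hk : L *ᵥ (e k).ofLp = 0
    · simp [hk]
    · exact (hterm k hk).le
  refine hL (toEuclideanLin.injective (e.toBasis.ext fun k => ?_))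
  simp [toLpLin_apply, hzero]

section Kronecker

variable {k z : Type*} {m : ℕ}

lemma idKron_mulVec_apply [Fintype z] (M : Matrix k z ℂ) (u : Fin m × z → ℂ) (i : Fin m) (a : k) :
    (idKron m M *ᵥ u) (i, a) = (M *ᵥ fun b => u (i, b)) a := by
  simp only [mulVec, dotProduct, idKron, kroneckerMap_apply, Fintype.sum_prod_type]
  rw [Finset.sum_eq_single i]
  · simp
  · intro j _ hj
    simp [Matrix.one_apply_ne hj.symm]
  · simp

lemma idKron_mulVec_mul [Fintype z] (M : Matrix k z ℂ) (v : Fin m → ℂ) (u : z → ℂ) :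
    idKron m M *ᵥ (fun p => v p.1 * u p.2) = fun p => v p.1 * (M *ᵥ u) p.2 := by
  ext ⟨i, a⟩
  rw [idKron_mulVec_apply]
  exact congrFun (mulVec_smul M (v i) u) a

lemma star_dotProduct_block_mulVec [Fintype z] (G : Fin m → Fin m → Matrix z z ℂ) (v : Fin m → ℂ)
    (u : z → ℂ) :
    star (fun p : Fin m × z => v p.1 * u p.2) ⬝ᵥ
        (of fun p q : Fin m × z => G p.1 q.1 p.2 q.2) *ᵥ (fun p => v p.1 * u p.2) =
      star v ⬝ᵥ (of fun i j => star u ⬝ᵥ G i j *ᵥ u) *ᵥ v := by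
  simp only [mulVec, dotProduct, of_apply, Fintype.sum_prod_type, Pi.star_apply, Finset.mul_sum,
    Finset.sum_mul, star_mul']
  refine Finset.sum_congr rfl fun i _ => ?_
  rw [Finset.sum_comm]
  refine Finset.sum_congr rfl fun j _ => Finset.sum_congr rfl fun a _ =>
    Finset.sum_congr rfl fun b _ => ?_
  ring

end Kronecker

lemma exists_smul_eq_of_smul_eq_smul {V : Type*} [AddCommGroup V] [Module ℂ V] {α β : ℂ}
    (hαβ : ¬(α = 0 ∧ β = 0)) {x y : V} (h : α • y = β • x) : ∃ w : V, x = α • w ∧ y = β • w := by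
  by_cases hα : α = 0
  · have hβ : β ≠ 0 := fun hβ => hαβ ⟨hα, hβ⟩
    refine ⟨β⁻¹ • y, ?_, (smul_inv_smul₀ hβ y).symm⟩
    rw [smul_comm, h, inv_smul_smul₀ hβ]
  · refine ⟨α⁻¹ • x, (smul_inv_smul₀ hα x).symm, ?_⟩
    rw [smul_comm, ← h, inv_smul_smul₀ hα]

lemma exists_forall_eq_smul_of_rank_eq {n : ℕ} {A : Matrix (Fin n) (Fin (n + 1)) ℂ}
    (hA : A.rank = n) :
    ∃ z : Fin (n + 1) → ℂ, z ≠ 0 ∧ A *ᵥ z = 0 ∧ ∀ u, A *ᵥ u = 0 → ∃ c : ℂ, u = c • z := by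
  have hsum := A.mulVecLin.finrank_range_add_finrank_ker
  have hker : Module.finrank ℂ (LinearMap.ker A.mulVecLin) = 1 := by
    rw [Module.finrank_fin_fun] at hsum
    change A.rank + _ = _ at hsum
    omega
  obtain ⟨⟨z, hz⟩, hz0, hspan⟩ := finrank_eq_one_iff'.1 hker
  refine ⟨z, fun h => hz0 (Subtype.ext h), hz, fun u hu => ?_⟩
  obtain ⟨c, hc⟩ := hspan ⟨u, hu⟩
  exact ⟨c, (congrArg Subtype.val hc).symm⟩

/-- **Yakubovich Lemma for a matrix frequency-domain inequality.**
With `n_z = n + 1`, `Γ_{Θ₁} ∩ Ω_{Θ₂}` containing more than one point and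
`rank(αN − βM) = n` on `Γ_{Θ₁} ∩ Ω_{Θ₂}`, positive definiteness of the `m × m` matrix
`(z*G_{ij}z)` on the relevant frequencies is equivalent to the LMI
`G ≻ Λ'_{I_m⊗M, I_m⊗N, Θ₁}(H₁) + Λ'_{I_m⊗M, I_m⊗N, Θ₂}(H₂)` with `H₂ ≻ 0`. -/
theorem yakubovich_lemma_matrix_FDI
    (n m : ℕ)
    (M N : Matrix (Fin n) (Fin (n + 1)) ℂ)
    (G : Fin m → Fin m → Matrix (Fin (n + 1)) (Fin (n + 1)) ℂ)
    (hGsym : ∀ i j, G i j = (G j i)ᴴ)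
    (Θ₁ Θ₂ : Matrix (Fin 2) (Fin 2) ℂ)
    (hΘ₁herm : Θ₁.IsHermitian) (hΘ₂herm : Θ₂.IsHermitian)
    (hΘ₁det : Θ₁.det.re < 0) (hΘ₂det : Θ₂.det.re < 0)
    (htwo : ∃ α₁ β₁ α₂ β₂ : ℂ, ¬(α₁ = 0 ∧ β₁ = 0) ∧ ¬(α₂ = 0 ∧ β₂ = 0) ∧
      (∀ c : ℂ, ¬(α₂ = c * α₁ ∧ β₂ = c * β₁)) ∧
      hermPairVal Θ₁ α₁ β₁ = 0 ∧ 0 ≤ (hermPairVal Θ₂ α₁ β₁).re ∧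
      hermPairVal Θ₁ α₂ β₂ = 0 ∧ 0 ≤ (hermPairVal Θ₂ α₂ β₂).re)
    (hrank : ∀ α β : ℂ, ¬(α = 0 ∧ β = 0) →
      hermPairVal Θ₁ α β = 0 → 0 ≤ (hermPairVal Θ₂ α β).re →
      (α • N - β • M).rank = n) :
    (∀ α β : ℂ, ¬(α = 0 ∧ β = 0) →
        hermPairVal Θ₁ α β = 0 → 0 ≤ (hermPairVal Θ₂ α β).re →
        ∀ z : Fin (n + 1) → ℂ, z ≠ 0 → (α • N - β • M) *ᵥ z = 0 →
          (Matrix.of fun i j : Fin m => star z ⬝ᵥ (G i j) *ᵥ z).PosDef)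
      ↔
    (∃ H₁ H₂ : Matrix (Fin m × Fin n) (Fin m × Fin n) ℂ,
        H₁.IsHermitian ∧ H₂.IsHermitian ∧ H₂.PosDef ∧
        ((Matrix.of fun p q : Fin m × Fin (n + 1) => G p.1 q.1 p.2 q.2) -
          (lyapAdj (idKron m M) (idKron m N) Θ₁ H₁ +
           lyapAdj (idKron m M) (idKron m N) Θ₂ H₂)).PosDef) := by
  have hblock : (of fun p q : Fin m × Fin (n + 1) => G p.1 q.1 p.2 q.2).IsHermitian := by
    ext p q
    rw [conjTranspose_apply, of_apply, of_apply, hGsym p.1 q.1, conjTranspose_apply]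
  constructor
  · intro hFDI
    obtain ⟨H₁, H₂, h₁, h₂, h⟩ := exists_posDef_sub_lyapAdj (idKron m M) (idKron m N) hΘ₁herm
      hΘ₂herm hΘ₁det htwo hblock (fun α β hαβ hval₁ hval₂ u hu hker => by
        obtain ⟨z, hz, hz0, hspan⟩ :=
          exists_forall_eq_smul_of_rank_eq (hrank α β hαβ hval₁ hval₂)
        have hcol : ∀ i, (α • N - β • M) *ᵥ (fun b => u (i, b)) = 0 := by
          intro i
          ext a
          have hia := congrFun hker (i, a)
          simp only [sub_mulVec, smul_mulVec, Pi.sub_apply, Pi.smul_apply,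
            idKron_mulVec_apply] at hia ⊢
          exact hia
        choose v hv using fun i => hspan _ (hcol i)
        have huv : u = fun p => v p.1 * z p.2 := by
          ext ⟨i, b⟩
          exact congrFun (hv i) b
        have hv0 : v ≠ 0 := by
          rintro rfl
          exact hu (by rw [huv]; ext p; simp)
        rw [huv, star_dotProduct_block_mulVec]
        exact (Complex.pos_iff.1
          ((hFDI α β hαβ hval₁ hval₂ z hz hz0).dotProduct_mulVec_pos hv0)).1)
    exact ⟨H₁, H₂, h₁, h₂.1, h₂, h⟩
  · rintro ⟨H₁, H₂, -, -, h₂, h⟩ α β hαβ hval₁ hval₂ z hz hker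
    have hherm : (of fun i j : Fin m => star z ⬝ᵥ G i j *ᵥ z).IsHermitian := by
      ext i j
      rw [conjTranspose_apply, of_apply, of_apply, hGsym i j, ← star_dotProduct_star,
        star_star, star_mulVec, ← dotProduct_mulVec]
    refine PosDef.of_dotProduct_mulVec_pos hherm fun v hv => Complex.pos_iff.2
      ⟨?_, (hherm.im_star_dotProduct_mulVec_self v).symm⟩
    rw [sub_mulVec, smul_mulVec, smul_mulVec, sub_eq_zero] at hker
    obtain ⟨w, hMz, hNz⟩ := exists_smul_eq_of_smul_eq_smul hαβ hker
    have hkron : ∀ (P : Matrix (Fin n) (Fin (n + 1)) ℂ) (c : ℂ), P *ᵥ z = c • w →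
        idKron m P *ᵥ (fun p => v p.1 * z p.2) = c • fun p => v p.1 * w p.2 := by
      intro P c hP
      rw [idKron_mulVec_mul, hP]
      ext p
      simp [mul_left_comm]
    have hne : (fun p : Fin m × Fin (n + 1) => v p.1 * z p.2) ≠ 0 := by
      obtain ⟨i, hi⟩ := Function.ne_iff.1 hv
      obtain ⟨a, ha⟩ := Function.ne_iff.1 hz
      exact Function.ne_iff.2 ⟨(i, a), mul_ne_zero hi ha⟩
    have hpos := (Complex.pos_iff.1 (h.dotProduct_mulVec_pos hne)).1
    have hnonneg := Complex.nonneg_iff.1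
      (h₂.posSemidef.dotProduct_mulVec_nonneg fun p => v p.1 * w p.2)
    rw [sub_mulVec, add_mulVec, dotProduct_sub, dotProduct_add, star_dotProduct_block_mulVec,
      star_dotProduct_lyapAdj_mulVec _ _ _ _ (hkron M α hMz) (hkron N β hNz),
      star_dotProduct_lyapAdj_mulVec _ _ _ _ (hkron M α hMz) (hkron N β hNz), hval₁, zero_mul,
      zero_add, Complex.sub_re, Complex.mul_re, ← hnonneg.2, mul_zero, sub_zero] at hpos
    linarith [mul_nonneg hval₂ hnonneg.1]
end
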